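/- arXiv:1810.07478 — 4 statements merged into one kernel-verified Lean document; each statement's English description precedes it below -/
import Mathlib

section
/- Let 0 < q < 1 and set w = 3 P₂(q)² P₃(q)⁴ / (P₁(q)⁴ P₆(q)²) (the eta quotient 3η₂²η₃⁴/(η₁⁴η₆²)). Then 10 − w² − 9/w² = −64 q (P₂(q) P₆(q) / (P₁(q) P₃(q)))⁶, i.e. the three-loop variable t = 10 − w² − 9/w² equals −64 (η₂η₆/(η₁η₃))⁶. -/
open scoped BigOperators

/-- `P m q = ∏_{k=1}^∞ (1 - q^(m k))` for real `q`. -/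
noncomputable def P (m : ℕ) (q : ℝ) : ℝ := ∏' k : ℕ, (1 - q ^ (m * (k + 1)))

open Filter Topology Finset

/-- The infinite `q`-shifted factorial `∏_{n ≥ 0} (1 + a q ^ n)`. -/
noncomputable def qProd (a q : ℂ) : ℂ := ∏' n : ℕ, (1 + a * q ^ n)

/-- The Euler product `∏_{n ≥ 1} (1 - q ^ n)`. -/
noncomputable def eulerProd (q : ℂ) : ℂ := qProd (-q) q

/-- The partial Euler product `∏_{n = 1}^{N} (1 - q ^ n)`. -/
noncomputable def eulerPartial (q : ℂ) (N : ℕ) : ℂ := ∏ n ∈ range N, (1 - q ^ (n + 1))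

/-- The general term of the theta series. -/
noncomputable def thetaTerm (z q : ℂ) (j : ℤ) : ℂ := z ^ j * q ^ (j * (j - 1) / 2)

lemma summable_norm_mul_pow (a : ℂ) {q : ℂ} (hq : ‖q‖ < 1) :
    Summable fun n : ℕ => ‖a * q ^ n‖ := by
  simpa [norm_mul, norm_pow] using
    (summable_geometric_of_lt_one (norm_nonneg q) hq).mul_left ‖a‖

lemma tendsto_qProd (a : ℂ) {q : ℂ} (hq : ‖q‖ < 1) :
    Tendsto (fun N => ∏ n ∈ range N, (1 + a * q ^ n)) atTop (𝓝 (qProd a q)) :=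
  (multipliable_one_add_of_summable (summable_norm_mul_pow a hq)).tendsto_prod_tprod_nat

lemma tendsto_eulerPartial {q : ℂ} (hq : ‖q‖ < 1) :
    Tendsto (eulerPartial q) atTop (𝓝 (eulerProd q)) := by
  refine (tendsto_qProd (-q) hq).congr fun N => prod_congr rfl fun n _ => ?_
  ring

lemma one_sub_pow_succ_ne_zero {q : ℂ} (hq : ‖q‖ < 1) (n : ℕ) : 1 - q ^ (n + 1) ≠ 0 := by
  intro h
  have h1 : ‖q ^ (n + 1)‖ = 1 := by rw [← sub_eq_zero.1 h]; simp
  rw [norm_pow] at h1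
  exact (pow_lt_one₀ (norm_nonneg q) hq n.succ_ne_zero).ne h1

lemma eulerPartial_ne_zero {q : ℂ} (hq : ‖q‖ < 1) (N : ℕ) : eulerPartial q N ≠ 0 :=
  prod_ne_zero_iff.2 fun n _ => one_sub_pow_succ_ne_zero hq n

lemma eulerProd_ne_zero {q : ℂ} (hq : ‖q‖ < 1) : eulerProd q ≠ 0 := by
  refine tprod_one_add_ne_zero_of_summable (f := fun n : ℕ => -q * q ^ n) (fun n => ?_)
    (summable_norm_mul_pow (-q) hq)
  have := one_sub_pow_succ_ne_zero hq n
  rwa [pow_succ', sub_eq_add_neg, ← neg_mul] at this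

lemma eulerPartial_succ (q : ℂ) (N : ℕ) :
    eulerPartial q (N + 1) = eulerPartial q N * (1 - q ^ (N + 1)) :=
  prod_range_succ _ _

/-- The Gaussian binomial coefficient, for `k ≤ N`. -/
noncomputable def gaussBinom (q : ℂ) (N k : ℕ) : ℂ :=
  eulerPartial q N / (eulerPartial q k * eulerPartial q (N - k))

lemma gaussBinom_zero {q : ℂ} (hq : ‖q‖ < 1) (N : ℕ) : gaussBinom q N 0 = 1 := by
  have h := eulerPartial_ne_zero hq N
  have h0 : eulerPartial q 0 = 1 := prod_range_zero _
  simp [gaussBinom, h0, h]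

lemma gaussBinom_self {q : ℂ} (hq : ‖q‖ < 1) (N : ℕ) : gaussBinom q N N = 1 := by
  have h := eulerPartial_ne_zero hq N
  have h0 : eulerPartial q 0 = 1 := prod_range_zero _
  simp [gaussBinom, h0, h]

lemma gaussBinom_succ_succ {q : ℂ} (hq : ‖q‖ < 1) {N k : ℕ} (hk : k < N) :
    gaussBinom q (N + 1) (k + 1) = gaussBinom q N (k + 1) + q ^ (N - k) * gaussBinom q N k := by
  obtain ⟨m, rfl⟩ := Nat.exists_eq_add_of_lt hk
  have e1 : k + m + 1 + 1 - (k + 1) = m + 1 := by omega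
  have e2 : k + m + 1 - (k + 1) = m := by omega
  have e3 : k + m + 1 - k = m + 1 := by omega
  simp only [gaussBinom, e1, e2, e3, eulerPartial_succ]
  have h1 := eulerPartial_ne_zero hq k
  have h2 := eulerPartial_ne_zero hq m
  have h4 := one_sub_pow_succ_ne_zero hq k
  have h5 := one_sub_pow_succ_ne_zero hq m
  field_simp
  ring

/-- The finite `q`-binomial theorem. -/
lemma prod_one_add_mul_pow_eq_sum_gaussBinom {q : ℂ} (hq : ‖q‖ < 1) (x : ℂ) (N : ℕ) :
    ∏ n ∈ range N, (1 + x * q ^ n) =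
      ∑ k ∈ range (N + 1), gaussBinom q N k * q ^ (k.choose 2) * x ^ k := by
  induction N with
  | zero => simp [gaussBinom_zero hq]
  | succ N ih =>
    have step : ∀ k ∈ range N, gaussBinom q (N + 1) (k + 1) * q ^ ((k + 1).choose 2) * x ^ (k + 1)
        = gaussBinom q N (k + 1) * q ^ ((k + 1).choose 2) * x ^ (k + 1)
          + (gaussBinom q N k * q ^ (k.choose 2) * x ^ k) * (x * q ^ N) := by
      intro k hk
      have hk := mem_range.1 hk
      rw [gaussBinom_succ_succ hq hk, Nat.choose_succ_succ' k 1, Nat.choose_one_right]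
      have : q ^ N = q ^ (N - k) * q ^ k := by rw [← pow_add]; congr 1; omega
      rw [this]
      ring
    have first := sum_range_succ' (fun k => gaussBinom q N k * q ^ (k.choose 2) * x ^ k) N
    have last := sum_range_succ (fun k => gaussBinom q N k * q ^ (k.choose 2) * x ^ k) N
    rw [prod_range_succ, ih, mul_add, mul_one]
    nth_rewrite 1 [first]
    rw [last, sum_range_succ' _ (N + 1), sum_range_succ _ N, sum_congr rfl step, sum_add_distrib,
      ← sum_mul, gaussBinom_self hq, gaussBinom_self hq, gaussBinom_zero hq, gaussBinom_zero hq,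
      Nat.choose_succ_succ' N 1, Nat.choose_one_right]
    ring

lemma int_mul_pred_div_two (j : ℤ) : 2 * (j * (j - 1) / 2) = j * (j - 1) :=
  Int.mul_ediv_cancel' (Int.even_mul_pred_self j).two_dvd

lemma thetaTerm_ne_zero {z q : ℂ} (hz : z ≠ 0) (hq0 : q ≠ 0) (j : ℤ) : thetaTerm z q j ≠ 0 :=
  mul_ne_zero (zpow_ne_zero _ hz) (zpow_ne_zero _ hq0)

lemma thetaTerm_add_one {z q : ℂ} (hz : z ≠ 0) (hq0 : q ≠ 0) (j : ℤ) :
    thetaTerm z q (j + 1) = z * q ^ j * thetaTerm z q j := by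
  have : (j + 1) * (j + 1 - 1) / 2 = j + j * (j - 1) / 2 := by
    have h1 := int_mul_pred_div_two (j + 1)
    have h2 := int_mul_pred_div_two j
    linarith
  rw [thetaTerm, this, zpow_add₀ hz, zpow_add₀ hq0, thetaTerm, zpow_one]
  ring

lemma thetaTerm_neg (z : ℂ) {q : ℂ} (hq0 : q ≠ 0) (j : ℤ) :
    thetaTerm z q (-j) = thetaTerm (q / z) q j := by
  have : -j * (-j - 1) / 2 = j + j * (j - 1) / 2 := by
    have h1 := int_mul_pred_div_two (-j)
    have h2 := int_mul_pred_div_two j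
    linarith
  rw [thetaTerm, this, thetaTerm, zpow_add₀ hq0, div_zpow, zpow_neg]
  ring

lemma summable_norm_thetaTerm_nat {z q : ℂ} (hz : z ≠ 0) (hq0 : q ≠ 0) (hq : ‖q‖ < 1) :
    Summable fun n : ℕ => ‖thetaTerm z q n‖ := by
  refine summable_of_ratio_test_tendsto_lt_one zero_lt_one
    (Eventually.of_forall fun n => norm_ne_zero_iff.2 (thetaTerm_ne_zero hz hq0 n)) ?_
  have : Tendsto (fun n : ℕ => ‖z‖ * ‖q‖ ^ n) atTop (𝓝 (‖z‖ * 0)) :=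
    (tendsto_pow_atTop_nhds_zero_of_lt_one (norm_nonneg q) hq).const_mul _
  rw [mul_zero] at this
  refine this.congr fun n => ?_
  have h := norm_ne_zero_iff.2 (thetaTerm_ne_zero hz hq0 n)
  rw [norm_norm, norm_norm, Nat.cast_succ, thetaTerm_add_one hz hq0, norm_mul, norm_mul,
    zpow_natCast, norm_pow]
  field_simp

lemma summable_norm_thetaTerm {z q : ℂ} (hz : z ≠ 0) (hq0 : q ≠ 0) (hq : ‖q‖ < 1) :
    Summable fun j : ℤ => ‖thetaTerm z q j‖ := by
  refine Summable.of_nat_of_neg (summable_norm_thetaTerm_nat hz hq0 hq) ?_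
  simp_rw [thetaTerm_neg _ hq0]
  exact summable_norm_thetaTerm_nat (div_ne_zero hq0 hz) hq0 hq

/-- The finite form of the Jacobi triple product identity. -/
lemma prod_mul_prod_eq_sum_thetaTerm {z q : ℂ} (hz : z ≠ 0) (hq0 : q ≠ 0) (hq : ‖q‖ < 1) (n : ℕ) :
    (∏ k ∈ range n, (1 + z * q ^ k)) * ∏ k ∈ range n, (1 + q / z * q ^ k) =
      ∑ k ∈ range (2 * n + 1), gaussBinom q (2 * n) k * thetaTerm z q ((k : ℤ) - n) := by
  have key := prod_one_add_mul_pow_eq_sum_gaussBinom hq (z / q ^ n) (2 * n)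
  have hterm : ∀ k : ℕ, thetaTerm z q ((k : ℤ) - n) =
      thetaTerm z q (-n) * (q ^ (k.choose 2) * (z / q ^ n) ^ k) := by
    intro k
    induction k with
    | zero => simp
    | succ k ih =>
      have : ((k + 1 : ℕ) : ℤ) - n = (k - n) + 1 := by push_cast; ring
      rw [this, thetaTerm_add_one hz hq0, ih, zpow_sub₀ hq0, Nat.choose_succ_succ' k 1,
        Nat.choose_one_right, zpow_natCast, zpow_natCast]
      ring
  have hprod : ∀ m : ℕ, thetaTerm z q (-m) * ∏ k ∈ range m, (1 + z / q ^ (k + 1)) =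
      ∏ k ∈ range m, (1 + q / z * q ^ k) := by
    intro m
    induction m with
    | zero => simp [thetaTerm]
    | succ m ih =>
      have h1 := thetaTerm_add_one hz hq0 (-(m + 1 : ℕ) : ℤ)
      have h2 : (-(m + 1 : ℕ) : ℤ) + 1 = -m := by push_cast; ring
      rw [h2] at h1
      rw [prod_range_succ, prod_range_succ, ← ih, h1, zpow_neg, zpow_natCast]
      field_simp
      ring
  simp_rw [hterm]
  rw [← hprod n, two_mul, prod_range_add] at *
  have hsplit : ∏ k ∈ range n, (1 + z / q ^ n * q ^ k) = ∏ k ∈ range n, (1 + z / q ^ (k + 1)) := by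
    rw [← prod_range_reflect]
    refine prod_congr rfl fun k hk => ?_
    have hk := mem_range.1 hk
    have : q ^ n = q ^ (n - 1 - k) * q ^ (k + 1) := by rw [← pow_add]; congr 1; omega
    rw [this]
    field_simp
  have hshift : ∏ k ∈ range n, (1 + z / q ^ n * q ^ (n + k)) = ∏ k ∈ range n, (1 + z * q ^ k) := by
    refine prod_congr rfl fun k _ => ?_
    rw [pow_add]
    field_simp
  rw [hsplit, hshift] at key
  rw [mul_left_comm, mul_comm (∏ k ∈ range n, (1 + z * q ^ k)), key, mul_sum]
  exact sum_congr rfl fun k _ => by ring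

lemma exists_norm_gaussBinom_le {q : ℂ} (hq : ‖q‖ < 1) :
    ∃ C : ℝ, ∀ N k : ℕ, ‖gaussBinom q N k‖ ≤ C := by
  obtain ⟨A, hA⟩ := (tendsto_eulerPartial hq).norm.bddAbove_range
  obtain ⟨B, hB⟩ := ((tendsto_eulerPartial hq).inv₀ (eulerProd_ne_zero hq)).norm.bddAbove_range
  have hA' : ∀ N, ‖eulerPartial q N‖ ≤ A := fun N => hA ⟨N, rfl⟩
  have hB' : ∀ N, ‖(eulerPartial q N)⁻¹‖ ≤ B := fun N => hB ⟨N, rfl⟩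
  have hA0 := (norm_nonneg _).trans (hA' 0)
  have hB0 := (norm_nonneg _).trans (hB' 0)
  refine ⟨A * (B * B), fun N k => ?_⟩
  rw [gaussBinom, div_eq_mul_inv, mul_inv, norm_mul, norm_mul]
  gcongr
  exacts [hA' _, hB' _, hB' _]

/-- The Jacobi triple product identity. -/
theorem jacobi_triple_product {z q : ℂ} (hz : z ≠ 0) (hq0 : q ≠ 0) (hq : ‖q‖ < 1) :
    ∑' j : ℤ, thetaTerm z q j = eulerProd q * qProd z q * qProd (q / z) q := by
  obtain ⟨C, hC⟩ := exists_norm_gaussBinom_le hq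
  have hE := eulerProd_ne_zero hq
  set F : ℕ → ℤ → ℂ := fun n j =>
    if j ∈ Icc (-(n : ℤ)) n then gaussBinom q (2 * n) (n + j).toNat * thetaTerm z q j else 0
    with hF
  have hlim : Tendsto (fun n => ∑' j, F n j) atTop
      (𝓝 (∑' j, (eulerProd q)⁻¹ * thetaTerm z q j)) := by
    refine tendsto_tsum_of_dominated_convergence
      ((summable_norm_thetaTerm hz hq0 hq).mul_left C) (fun j => ?_)
      (Eventually.of_forall fun n j => ?_)
    · have h1 : Tendsto (fun n : ℕ => 2 * n) atTop atTop :=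
        tendsto_atTop_mono (fun n => by simp only [id]; omega) tendsto_id
      have h2 : Tendsto (fun n : ℕ => ((n : ℤ) + j).toNat) atTop atTop :=
        tendsto_atTop.2 fun b => by
          filter_upwards [eventually_ge_atTop (b + j.natAbs)] with n hn
          omega
      have h3 : Tendsto (fun n : ℕ => 2 * n - ((n : ℤ) + j).toNat) atTop atTop :=
        tendsto_atTop.2 fun b => by
          filter_upwards [eventually_ge_atTop (b + j.natAbs)] with n hn
          omega
      have hT := tendsto_eulerPartial hq
      have h4 := ((hT.comp h1).div ((hT.comp h2).mul (hT.comp h3))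
        (mul_ne_zero hE hE)).mul_const (thetaTerm z q j)
      have h5 : eulerProd q / (eulerProd q * eulerProd q) = (eulerProd q)⁻¹ := by field_simp
      rw [h5] at h4
      refine h4.congr' ?_
      filter_upwards [eventually_ge_atTop j.natAbs] with n hn
      have : j ∈ Icc (-(n : ℤ)) n := by rw [mem_Icc]; omega
      simp only [hF, this, if_true, gaussBinom]
      rfl
    · by_cases h : j ∈ Icc (-(n : ℤ)) n
      · simp only [hF, h, if_true, norm_mul]
        gcongr
        exact hC _ _
      · simp only [hF, h, if_false, norm_zero]
        exact mul_nonneg ((norm_nonneg _).trans (hC 0 0)) (norm_nonneg _)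
  have hsum : ∀ n, ∑' j, F n j =
      (∏ k ∈ range n, (1 + z * q ^ k)) * ∏ k ∈ range n, (1 + q / z * q ^ k) := by
    intro n
    rw [prod_mul_prod_eq_sum_thetaTerm hz hq0 hq, tsum_eq_sum (s := Icc (-(n : ℤ)) n)
      fun j hj => by simp only [hF, hj, if_false]]
    refine (sum_bij (fun (k : ℕ) _ => (k : ℤ) - n) ?_ ?_ ?_ ?_).symm
    · intro k hk
      rw [mem_range] at hk
      rw [mem_Icc]
      omega
    · intro a _ b _ h
      omega
    · intro j hj
      rw [mem_Icc] at hj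
      exact ⟨(n + j).toNat, mem_range.2 (by omega), by omega⟩
    · intro k hk
      rw [mem_range] at hk
      have h1 : (k : ℤ) - n ∈ Icc (-(n : ℤ)) n := by rw [mem_Icc]; omega
      have h2 : ((n : ℤ) + (k - n)).toNat = k := by omega
      simp only [hF, h1, if_true, h2]
  simp_rw [hsum] at hlim
  have := tendsto_nhds_unique hlim ((tendsto_qProd z hq).mul (tendsto_qProd (q / z) hq))
  rw [tsum_mul_left] at this
  rw [mul_assoc, ← this, mul_inv_cancel_left₀ hE]

lemma norm_pow_lt_one {q : ℂ} (hq : ‖q‖ < 1) {n : ℕ} (hn : n ≠ 0) : ‖q ^ n‖ < 1 := by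
  simpa using pow_lt_one₀ (norm_nonneg q) hq hn

lemma qProd_bisect (a : ℂ) {q : ℂ} (hq : ‖q‖ < 1) :
    qProd a q = qProd a (q ^ 2) * qProd (a * q) (q ^ 2) := by
  have h2 := norm_pow_lt_one hq two_ne_zero
  refine tendsto_nhds_unique
    ((tendsto_qProd a hq).comp (tendsto_id.const_mul_atTop' (by norm_num : 0 < 2)))
    (((tendsto_qProd a h2).mul (tendsto_qProd (a * q) h2)).congr fun N => ?_)
  induction N with
  | zero => simp
  | succ N ih =>
    simp only [Function.comp_apply, id, mul_add, mul_one, prod_range_succ] at ih ⊢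
    rw [← ih]
    ring

lemma qProd_trisect (a : ℂ) {q : ℂ} (hq : ‖q‖ < 1) :
    qProd a q = qProd a (q ^ 3) * qProd (a * q) (q ^ 3) * qProd (a * q ^ 2) (q ^ 3) := by
  have h3 := norm_pow_lt_one hq three_ne_zero
  refine tendsto_nhds_unique
    ((tendsto_qProd a hq).comp (tendsto_id.const_mul_atTop' (by norm_num : 0 < 3)))
    ((((tendsto_qProd a h3).mul (tendsto_qProd (a * q) h3)).mul
      (tendsto_qProd (a * q ^ 2) h3)).congr fun N => ?_)
  induction N with
  | zero => simp
  | succ N ih =>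
    simp only [Function.comp_apply, id, mul_add, mul_one, prod_range_succ] at ih ⊢
    rw [← ih]
    ring

lemma qProd_mul_qProd_neg (a : ℂ) {q : ℂ} (hq : ‖q‖ < 1) :
    qProd a q * qProd (-a) q = qProd (-a ^ 2) (q ^ 2) := by
  have h2 := norm_pow_lt_one hq two_ne_zero
  refine tendsto_nhds_unique ((tendsto_qProd a hq).mul (tendsto_qProd (-a) hq))
    ((tendsto_qProd (-a ^ 2) h2).congr fun N => ?_)
  rw [← prod_mul_distrib]
  exact prod_congr rfl fun n _ => by ring

lemma qProd_mul_cube_roots (a : ℂ) {q w : ℂ} (hq : ‖q‖ < 1) (hw : w ^ 2 + w + 1 = 0) :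
    qProd a q * qProd (w * a) q * qProd (w ^ 2 * a) q = qProd (a ^ 3) (q ^ 3) := by
  have h3 := norm_pow_lt_one hq three_ne_zero
  refine tendsto_nhds_unique (((tendsto_qProd a hq).mul (tendsto_qProd (w * a) hq)).mul
    (tendsto_qProd (w ^ 2 * a) hq)) ((tendsto_qProd (a ^ 3) h3).congr fun N => ?_)
  rw [← prod_mul_distrib, ← prod_mul_distrib]
  refine prod_congr rfl fun n _ => ?_
  rw [pow_right_comm]
  generalize q ^ n = t
  linear_combination (-(a * t) - (a * t) ^ 2 * w - (a * t) ^ 3 * (w - 1)) * hw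

lemma qProd_eq_one_add_mul (a : ℂ) {q : ℂ} (hq : ‖q‖ < 1) :
    qProd a q = (1 + a) * qProd (a * q) q := by
  refine tendsto_nhds_unique ((tendsto_qProd a hq).comp (tendsto_add_atTop_nat 1))
    (((tendsto_qProd (a * q) hq).const_mul (1 + a)).congr fun N => ?_)
  simp only [Function.comp_apply]
  rw [prod_range_succ', pow_zero, mul_one, mul_comm]
  exact congrArg (· * _) (prod_congr rfl fun n _ => by ring)

/-- The product of the Euler product over the three cube roots of `r ^ 3`. -/
lemma eulerProd_mul_cube_roots {r w : ℂ} (hr : ‖r‖ < 1) (hw : w ^ 2 + w + 1 = 0) :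
    eulerProd r * eulerProd (w * r) * eulerProd (w ^ 2 * r) * eulerProd (r ^ 9) =
      eulerProd (r ^ 3) ^ 4 := by
  have hw3 : w ^ 3 = 1 := by linear_combination (w - 1) * hw
  have hw1 := Complex.norm_eq_one_of_pow_eq_one hw3 three_ne_zero
  have hr3 := norm_pow_lt_one hr three_ne_zero
  have e1 : (w * r) ^ 3 = r ^ 3 := by rw [mul_pow, hw3, one_mul]
  have e2 : (w ^ 2 * r) ^ 3 = r ^ 3 := by linear_combination (w ^ 3 + 1) * r ^ 3 * hw3
  have t0 := qProd_trisect (-r) hr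
  have t1 := qProd_trisect (-(w * r)) (q := w * r) (by simpa [hw1] using hr)
  have t2 := qProd_trisect (-(w ^ 2 * r)) (q := w ^ 2 * r) (by simpa [hw1] using hr)
  have t3 := qProd_trisect (-r ^ 3) hr3
  have c1 := qProd_mul_cube_roots (-r) hr3 hw
  have c2 := qProd_mul_cube_roots (-r ^ 2) hr3 hw
  rw [e1] at t1
  rw [e2] at t2
  have f1 : -(w * r) * (w * r) = w ^ 2 * -r ^ 2 := by ring
  have f2 : -(w * r) * (w * r) ^ 2 = -r ^ 3 := by linear_combination -r ^ 3 * hw3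
  have f3 : -(w ^ 2 * r) * (w ^ 2 * r) = w * -r ^ 2 := by linear_combination -(w * r ^ 2) * hw3
  have f4 : -(w ^ 2 * r) * (w ^ 2 * r) ^ 2 = -r ^ 3 := by
    linear_combination -(w ^ 3 + 1) * r ^ 3 * hw3
  have f5 : -r * r = -r ^ 2 := by ring
  have f6 : -r * r ^ 2 = -r ^ 3 := by ring
  have f7 : (-r) ^ 3 = -r ^ 3 := by ring
  have f8 : (-r ^ 2) ^ 3 = -r ^ 3 * r ^ 3 := by ring
  have f9 : -r ^ 3 * (r ^ 3) ^ 2 = -r ^ 9 := by ring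
  have f10 : (r ^ 3) ^ 3 = r ^ 9 := by ring
  have f11 : -(w * r) = w * -r := by ring
  have f12 : -(w ^ 2 * r) = w ^ 2 * -r := by ring
  rw [f1, f2, f11] at t1
  rw [f3, f4, f12] at t2
  rw [f5, f6] at t0
  rw [f7, f10] at c1
  rw [f8, f10] at c2
  rw [f9, f10] at t3
  simp only [eulerProd, f11, f12]
  rw [t0, t1, t2]
  calc _ = (qProd (-r) (r ^ 3) * qProd (w * -r) (r ^ 3) * qProd (w ^ 2 * -r) (r ^ 3)) *
        (qProd (-r ^ 2) (r ^ 3) * qProd (w * -r ^ 2) (r ^ 3) * qProd (w ^ 2 * -r ^ 2) (r ^ 3)) *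
        qProd (-r ^ 9) (r ^ 9) * qProd (-r ^ 3) (r ^ 3) ^ 3 := by ring
    _ = _ := by rw [c1, c2, ← t3]; ring

/-- The theta series `∑_j z ^ j q ^ (j (j - 1) / 2)`. -/
noncomputable def theta (z q : ℂ) : ℂ := ∑' j : ℤ, thetaTerm z q j

lemma theta_div {q : ℂ} (hq0 : q ≠ 0) (z : ℂ) : theta (q / z) q = theta z q := by
  rw [theta, theta, ← (Equiv.neg ℤ).tsum_eq (thetaTerm z q)]
  exact tsum_congr fun j => (thetaTerm_neg z hq0 j).symm

lemma theta_eq_mul_theta_mul {z q : ℂ} (hz : z ≠ 0) (hq0 : q ≠ 0) :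
    theta z q = z * theta (z * q) q := by
  rw [theta, theta, ← (Equiv.addRight (1 : ℤ)).tsum_eq (thetaTerm z q), ← tsum_mul_left]
  refine tsum_congr fun j => ?_
  rw [Equiv.coe_addRight, thetaTerm_add_one hz hq0, thetaTerm, thetaTerm, mul_zpow]
  ring

lemma thetaTerm_three_mul_add {z q : ℂ} (hz : z ≠ 0) (hq0 : q ≠ 0) (m i : ℤ) :
    thetaTerm z q (3 * m + i) =
      z ^ i * q ^ (i * (i - 1) / 2) * thetaTerm (z ^ 3 * q ^ (3 + 3 * i)) (q ^ 9) m := by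
  have : (3 * m + i) * (3 * m + i - 1) / 2 =
      i * (i - 1) / 2 + (3 + 3 * i) * m + 9 * (m * (m - 1) / 2) := by
    have h1 := int_mul_pred_div_two (3 * m + i)
    have h2 := int_mul_pred_div_two m
    have h3 := int_mul_pred_div_two i
    linarith
  rw [thetaTerm, this, zpow_add₀ hz, zpow_add₀ hq0, zpow_add₀ hq0, thetaTerm, mul_zpow,
    zpow_mul z, zpow_mul q (3 + 3 * i), zpow_mul q 9]
  norm_cast
  ring

lemma tsum_int_trisect {f : ℤ → ℂ} (hf : Summable f) :
    ∑' j, f j = ∑' m, f (3 * m) + ∑' m, f (3 * m + 1) + ∑' m, f (3 * m + 2) := by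
  have hsum : Summable fun p => f ((Int.divModEquiv 3).symm p) :=
    (Int.divModEquiv 3).symm.summable_iff.2 hf
  rw [← (Int.divModEquiv 3).symm.tsum_eq f, hsum.tsum_prod]
  simp only [tsum_fintype, Fin.sum_univ_three, Int.divModEquiv_symm_apply]
  have hs : ∀ i : ℤ, Summable fun m : ℤ => f (3 * m + i) := fun i =>
    hf.comp_injective fun a b h => by simpa using h
  rw [← Summable.tsum_add (by simpa using hs 0) (hs 1),
    ← Summable.tsum_add ((by simpa using hs 0 : Summable fun m => f (3 * m)).add (hs 1)) (hs 2)]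
  refine tsum_congr fun m => ?_
  simp [mul_comm]

lemma theta_trisect {z q : ℂ} (hz : z ≠ 0) (hq0 : q ≠ 0) (hq : ‖q‖ < 1) :
    theta z q = theta (z ^ 3 * q ^ 3) (q ^ 9) + z * theta (z ^ 3 * q ^ 6) (q ^ 9) +
      z ^ 2 * q * theta (z ^ 3 * q ^ 9) (q ^ 9) := by
  rw [theta, tsum_int_trisect (summable_norm_thetaTerm hz hq0 hq).of_norm]
  simp only [theta, ← tsum_mul_left]
  congr 1
  congr 1
  · refine tsum_congr fun m => ?_
    simpa using thetaTerm_three_mul_add hz hq0 m 0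
  · refine tsum_congr fun m => ?_
    simpa using thetaTerm_three_mul_add hz hq0 m 1
  · refine tsum_congr fun m => ?_
    simpa using thetaTerm_three_mul_add hz hq0 m 2

lemma theta_one_trisect {r : ℂ} (hr0 : r ≠ 0) (hr : ‖r‖ < 1) :
    theta 1 r = 2 * theta (r ^ 3) (r ^ 9) + r * theta 1 (r ^ 9) := by
  have h9 : r ^ 9 ≠ 0 := pow_ne_zero _ hr0
  have h1 := theta_div h9 (r ^ 3)
  have h2 := theta_div h9 1
  have h3 : r ^ 9 / r ^ 3 = r ^ 6 := by field_simp
  rw [h3] at h1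
  rw [div_one] at h2
  rw [theta_trisect one_ne_zero hr0 hr]
  simp only [one_pow, one_mul, h1, h2]
  ring

lemma theta_neg_sq_trisect {r : ℂ} (hr0 : r ≠ 0) (hr : ‖r‖ < 1) :
    theta (-r) (r ^ 2) = theta (-r ^ 9) (r ^ 18) - 2 * r * theta (-r ^ 3) (r ^ 18) := by
  have h18 : r ^ 18 ≠ 0 := pow_ne_zero _ hr0
  have hr2 := norm_pow_lt_one hr two_ne_zero
  have h1 := theta_div h18 (-r ^ 3)
  have h2 := theta_eq_mul_theta_mul (neg_ne_zero.2 (pow_ne_zero 3 hr0)) h18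
  have h3 : r ^ 18 / -r ^ 3 = -r ^ 15 := by field_simp
  rw [h3] at h1
  rw [theta_trisect (neg_ne_zero.2 hr0) (pow_ne_zero 2 hr0) hr2]
  have e1 : (-r) ^ 3 * (r ^ 2) ^ 3 = -r ^ 9 := by ring
  have e2 : (-r) ^ 3 * (r ^ 2) ^ 6 = -r ^ 15 := by ring
  have e3 : (-r) ^ 3 * (r ^ 2) ^ 9 = -r ^ 3 * r ^ 18 := by ring
  have e4 : (r ^ 2) ^ 9 = r ^ 18 := by ring
  rw [e1, e2, e3, e4, h1]
  linear_combination r * h2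

lemma eulerProd_mul_qProd_self {q : ℂ} (hq : ‖q‖ < 1) :
    eulerProd q * qProd q q = eulerProd (q ^ 2) := by
  rw [mul_comm, eulerProd, qProd_mul_qProd_neg q hq, eulerProd]

lemma qProd_neg_sq_mul_eulerProd {q : ℂ} (hq : ‖q‖ < 1) :
    qProd (-q) (q ^ 2) * eulerProd (q ^ 2) = eulerProd q := by
  rw [eulerProd, eulerProd, qProd_bisect (-q) hq]
  congr 2
  ring

lemma theta_one_eq {q : ℂ} (hq0 : q ≠ 0) (hq : ‖q‖ < 1) :
    theta 1 q = 2 * eulerProd (q ^ 2) ^ 2 / eulerProd q := by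
  have h := qProd_eq_one_add_mul 1 hq
  rw [theta, jacobi_triple_product one_ne_zero hq0 hq, h, ← eulerProd_mul_qProd_self hq, div_one,
    one_mul]
  field_simp [eulerProd_ne_zero hq]
  ring

lemma theta_neg_sq_eq {q : ℂ} (hq0 : q ≠ 0) (hq : ‖q‖ < 1) :
    theta (-q) (q ^ 2) = eulerProd q ^ 2 / eulerProd (q ^ 2) := by
  have hq2 := norm_pow_lt_one hq two_ne_zero
  have h1 : q ^ 2 / -q = -q := by field_simp
  rw [theta, jacobi_triple_product (neg_ne_zero.2 hq0) (pow_ne_zero 2 hq0) hq2, h1,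
    ← qProd_neg_sq_mul_eulerProd hq]
  field_simp [eulerProd_ne_zero hq2]

lemma theta_cube_eq {q : ℂ} (hq0 : q ≠ 0) (hq : ‖q‖ < 1) :
    theta q (q ^ 3) =
      eulerProd (q ^ 2) * eulerProd (q ^ 3) ^ 2 / (eulerProd q * eulerProd (q ^ 6)) := by
  have hq3 := norm_pow_lt_one hq three_ne_zero
  have h1 : q ^ 3 / q = q * q := by field_simp
  have h2 := eulerProd_mul_qProd_self hq3
  have h3 : (q ^ 3) ^ 2 = q ^ 6 := by ring
  have h4 : q * q ^ 2 = q ^ 3 := by ring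
  rw [h3] at h2
  rw [theta, jacobi_triple_product hq0 (pow_ne_zero 3 hq0) hq3, h1,
    eq_div_iff (mul_ne_zero (eulerProd_ne_zero hq)
      (eulerProd_ne_zero (norm_pow_lt_one hq (by norm_num)))),
    ← eulerProd_mul_qProd_self hq, qProd_trisect q hq, h4, ← h2]
  ring

lemma theta_neg_six_eq {q : ℂ} (hq0 : q ≠ 0) (hq : ‖q‖ < 1) :
    theta (-q) (q ^ 6) =
      eulerProd q * eulerProd (q ^ 6) ^ 2 / (eulerProd (q ^ 2) * eulerProd (q ^ 3)) := by
  have hq2 := norm_pow_lt_one hq two_ne_zero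
  have hq3 := norm_pow_lt_one hq three_ne_zero
  have hq6 := norm_pow_lt_one hq (by norm_num : 6 ≠ 0)
  have h1 : q ^ 6 / -q = -q ^ 5 := by field_simp
  have h2 := qProd_neg_sq_mul_eulerProd hq3
  have h3 := qProd_trisect (-q) hq2
  have e1 : (q ^ 3) ^ 2 = q ^ 6 := by ring
  have e2 : (q ^ 2) ^ 3 = q ^ 6 := by ring
  have e3 : -q * q ^ 2 = -q ^ 3 := by ring
  have e4 : -q * (q ^ 2) ^ 2 = -q ^ 5 := by ring
  rw [e1] at h2
  rw [e2, e3, e4] at h3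
  rw [theta, jacobi_triple_product (neg_ne_zero.2 hq0) (pow_ne_zero 6 hq0) hq6, h1,
    eq_div_iff (mul_ne_zero (eulerProd_ne_zero hq2) (eulerProd_ne_zero hq3)),
    ← qProd_neg_sq_mul_eulerProd hq, h3, ← h2]
  ring

lemma exists_primitive_cube_root : ∃ w : ℂ, w ^ 2 + w + 1 = 0 := by
  have h := (Complex.isPrimitiveRoot_exp 3 three_ne_zero).geom_sum_eq_zero (by norm_num)
  simp only [sum_range_succ, range_zero, sum_empty, pow_zero, pow_one, zero_add] at h
  exact ⟨_, by linear_combination h⟩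

/-- The two relations between the Euler products of level six. -/
theorem eulerProd_level_six {q : ℂ} (hq0 : q ≠ 0) (hq : ‖q‖ < 1) :
    eulerProd q * eulerProd (q ^ 2) ^ 3 * eulerProd (q ^ 3) ^ 9 +
        q * eulerProd q ^ 4 * eulerProd (q ^ 6) ^ 9 =
      eulerProd (q ^ 2) ^ 8 * eulerProd (q ^ 3) ^ 4 * eulerProd (q ^ 6) ∧
    eulerProd (q ^ 2) ^ 4 * eulerProd (q ^ 3) ^ 9 -
        8 * q * eulerProd q ^ 3 * eulerProd (q ^ 2) * eulerProd (q ^ 6) ^ 9 =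
      eulerProd q ^ 8 * eulerProd (q ^ 3) * eulerProd (q ^ 6) ^ 4 := by
  obtain ⟨r, rfl⟩ := IsAlgClosed.exists_pow_nat_eq q three_pos
  obtain ⟨w, hw⟩ := exists_primitive_cube_root
  have hr0 : r ≠ 0 := fun h => hq0 (by simp [h])
  have hr : ‖r‖ < 1 := by
    by_contra h
    rw [norm_pow] at hq
    exact hq.not_ge (one_le_pow₀ (not_lt.1 h))
  have hw3 : w ^ 3 = 1 := by linear_combination (w - 1) * hw
  have hw0 : w ≠ 0 := fun h => by simp [h] at hw3
  have hw1 := Complex.norm_eq_one_of_pow_eq_one hw3 three_ne_zero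
  have hw' : (w ^ 2) ^ 2 + w ^ 2 + 1 = 0 := by linear_combination (w ^ 2 - w + 1) * hw
  have hr2 := norm_pow_lt_one hr two_ne_zero
  have H1 := eulerProd_mul_cube_roots hr hw
  have H2 := eulerProd_mul_cube_roots hr2 hw'
  have c1 : (w * r) ^ 3 = r ^ 3 := by linear_combination r ^ 3 * hw3
  have c2 : (w ^ 2 * r) ^ 3 = r ^ 3 := by linear_combination (w ^ 3 + 1) * r ^ 3 * hw3
  have pow9 (s : ℂ) : s ^ 9 = (s ^ 3) ^ 3 := by ring
  have pow18 (s : ℂ) : s ^ 18 = (s ^ 3) ^ 6 := by ring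
  have hs1 : ‖w * r‖ < 1 := by simpa [hw1] using hr
  have hs2 : ‖w ^ 2 * r‖ < 1 := by simpa [hw1] using hr
  have hs1' : w * r ≠ 0 := mul_ne_zero hw0 hr0
  have hs2' : w ^ 2 * r ≠ 0 := mul_ne_zero (pow_ne_zero 2 hw0) hr0
  have T0 := theta_one_trisect hr0 hr
  have T1 := theta_one_trisect hs1' hs1
  have T2 := theta_one_trisect hs2' hs2
  have N0 := theta_neg_sq_trisect hr0 hr
  have N1 := theta_neg_sq_trisect hs1' hs1
  have N2 := theta_neg_sq_trisect hs2' hs2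
  rw [theta_one_eq hr0 hr, pow9] at T0
  rw [theta_one_eq hs1' hs1, pow9, c1] at T1
  rw [theta_one_eq hs2' hs2, pow9, c2] at T2
  rw [theta_neg_sq_eq hr0 hr, pow9, pow18] at N0
  rw [theta_neg_sq_eq hs1' hs1, pow9, pow18, c1] at N1
  rw [theta_neg_sq_eq hs2' hs2, pow9, pow18, c2] at N2
  have g1 := eulerProd_ne_zero hr
  have g2 := eulerProd_ne_zero hs1
  have g3 := eulerProd_ne_zero hs2
  have g4 := eulerProd_ne_zero hr2
  have g5 := eulerProd_ne_zero (norm_pow_lt_one hs1 two_ne_zero)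
  have g6 := eulerProd_ne_zero (norm_pow_lt_one hs2 two_ne_zero)
  rw [pow9] at H1
  rw [← mul_pow, ← mul_pow, show (r ^ 2) ^ 9 = (r ^ 3) ^ 6 by ring,
    show (r ^ 2) ^ 3 = (r ^ 3) ^ 2 by ring] at H2
  have hQ3 := norm_pow_lt_one hq three_ne_zero
  have hA := theta_cube_eq hq0 hq
  have hB := theta_neg_six_eq hq0 hq
  have hV := theta_one_eq (pow_ne_zero 3 hq0) hQ3
  have hU := theta_neg_sq_eq (pow_ne_zero 3 hq0) hQ3
  rw [show ((r ^ 3) ^ 3) ^ 2 = (r ^ 3) ^ 6 by ring] at hV hU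
  have k1 := eulerProd_ne_zero hq
  have k2 := eulerProd_ne_zero (norm_pow_lt_one hq two_ne_zero)
  have k3 := eulerProd_ne_zero hQ3
  have k6 := eulerProd_ne_zero (norm_pow_lt_one hq (by norm_num : 6 ≠ 0))
  rw [hA, hV] at T0 T1 T2
  rw [hU, hB] at N0 N1 N2
  generalize eulerProd (r ^ 3) = e1 at *
  generalize eulerProd ((r ^ 3) ^ 2) = e2 at *
  generalize eulerProd ((r ^ 3) ^ 3) = e3 at *
  generalize eulerProd ((r ^ 3) ^ 6) = e6 at *
  generalize eulerProd r = x0 at *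
  generalize eulerProd (w * r) = x1 at *
  generalize eulerProd (w ^ 2 * r) = x2 at *
  generalize eulerProd (r ^ 2) = y0 at *
  generalize eulerProd ((w * r) ^ 2) = y1 at *
  generalize eulerProd ((w ^ 2 * r) ^ 2) = y2 at *
  have hx : x0 * x1 * x2 = e1 ^ 4 / e3 := by rw [eq_div_iff k3, H1]
  have hy : y0 * y1 * y2 = e2 ^ 4 / e6 := by rw [eq_div_iff k6, H2]
  have cube (a b : ℂ) :
      (a + r * b) * (a + w * r * b) * (a + w ^ 2 * r * b) = a ^ 3 + r ^ 3 * b ^ 3 := by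
    linear_combination
      (a ^ 2 * r * b + a * r ^ 2 * b ^ 2 * w + r ^ 3 * b ^ 3 * (w - 1)) * hw
  constructor
  · have hprod := cube (2 * (e2 * e3 ^ 2 / (e1 * e6))) (2 * e6 ^ 2 / e3)
    rw [← T0, ← T1, ← T2] at hprod
    have hl : 2 * y0 ^ 2 / x0 * (2 * y1 ^ 2 / x1) * (2 * y2 ^ 2 / x2) =
        8 * (y0 * y1 * y2) ^ 2 / (x0 * x1 * x2) := by
      field_simp
      ring
    rw [hl, hx, hy] at hprod
    field_simp at hprod
    linear_combination -hprod / 8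
  · have hprod := cube (e3 ^ 2 / e6) (-2 * (e1 * e6 ^ 2 / (e2 * e3)))
    have sub_eq (s : ℂ) : e3 ^ 2 / e6 + s * (-2 * (e1 * e6 ^ 2 / (e2 * e3))) =
        e3 ^ 2 / e6 - 2 * s * (e1 * e6 ^ 2 / (e2 * e3)) := by ring
    rw [sub_eq, sub_eq, sub_eq, ← N0, ← N1, ← N2] at hprod
    have hl : x0 ^ 2 / y0 * (x1 ^ 2 / y1) * (x2 ^ 2 / y2) =
        (x0 * x1 * x2) ^ 2 / (y0 * y1 * y2) := by
      field_simp
    rw [hl, hx, hy] at hprod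
    field_simp at hprod
    linear_combination -hprod

lemma ofReal_P {q : ℝ} (hq0 : 0 < q) (hq1 : q < 1) {m : ℕ} (hm : m ≠ 0) :
    (P m q : ℂ) = eulerProd ((q : ℂ) ^ m) := by
  have hnorm : ‖(q ^ m : ℝ)‖ < 1 := by
    rw [Real.norm_of_nonneg (by positivity)]
    exact pow_lt_one₀ hq0.le hq1 hm
  have hmul : Multipliable fun k : ℕ => 1 - q ^ (m * (k + 1)) := by
    have hs : Summable fun k : ℕ => ‖-q ^ (m * (k + 1))‖ := by
      simp_rw [norm_neg, pow_mul, norm_pow _ (_ + 1)]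
      exact (summable_nat_add_iff 1).2 (summable_geometric_of_lt_one (norm_nonneg _) hnorm)
    simpa [sub_eq_add_neg] using multipliable_one_add_of_summable hs
  have := hmul.map_tprod Complex.ofRealHom Complex.continuous_ofReal
  rw [Complex.ofRealHom_eq_coe] at this
  rw [P, this, eulerProd, qProd]
  refine tprod_congr fun k => ?_
  rw [Complex.ofRealHom_eq_coe]
  push_cast
  rw [pow_mul]
  ring

/-- With `w = 3η₂²η₃⁴/(η₁⁴η₆²)`, the three-loop variable `t = 10 - w² - 9/w²` equals
`-64(η₂η₆/(η₁η₃))⁶`, i.e. `-64 q (P₂P₆/(P₁P₃))⁶`. -/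
theorem three_loop_t_eta (q : ℝ) (hq0 : 0 < q) (hq1 : q < 1) :
    (fun w : ℝ => 10 - w ^ 2 - 9 / w ^ 2)
        (3 * (P 2 q) ^ 2 * (P 3 q) ^ 4 / ((P 1 q) ^ 4 * (P 6 q) ^ 2)) =
      -64 * q * (P 2 q * P 6 q / (P 1 q * P 3 q)) ^ 6 := by
  have hqc : ‖(q : ℂ)‖ < 1 := by rwa [Complex.norm_real, Real.norm_of_nonneg hq0.le]
  have ne {m : ℕ} (hm : m ≠ 0) : P m q ≠ 0 := by
    have := eulerProd_ne_zero (norm_pow_lt_one hqc hm)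
    rw [← ofReal_P hq0 hq1 hm] at this
    exact_mod_cast this
  obtain ⟨h1, h2⟩ := eulerProd_level_six (Complex.ofReal_ne_zero.2 hq0.ne') hqc
  have hP1 := ofReal_P hq0 hq1 one_ne_zero
  rw [pow_one] at hP1
  rw [← hP1, ← ofReal_P hq0 hq1 two_ne_zero, ← ofReal_P hq0 hq1 three_ne_zero,
    ← ofReal_P hq0 hq1 (by norm_num : 6 ≠ 0)] at h1 h2
  norm_cast at h1 h2
  have n1 := ne one_ne_zero
  have n2 := ne two_ne_zero
  have n3 := ne three_ne_zero
  have n6 := ne (by norm_num : 6 ≠ 0)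
  generalize P 1 q = a at *
  generalize P 2 q = b at *
  generalize P 3 q = c at *
  generalize P 6 q = d at *
  have hX : b ^ 4 * c ^ 8 - a ^ 8 * d ^ 4 = 8 * q * a ^ 3 * b * d ^ 9 / c := by
    rw [eq_div_iff n3]
    linear_combination h2
  have hY : 9 * (b ^ 4 * c ^ 8) - a ^ 8 * d ^ 4 = 8 * b ^ 9 * c ^ 3 * d / a := by
    rw [eq_div_iff n1]
    apply mul_right_cancel₀ n3
    linear_combination a * h2 + 8 * b * h1
  have factor : (fun w : ℝ => 10 - w ^ 2 - 9 / w ^ 2) (3 * b ^ 2 * c ^ 4 / (a ^ 4 * d ^ 2)) =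
      -((b ^ 4 * c ^ 8 - a ^ 8 * d ^ 4) * (9 * (b ^ 4 * c ^ 8) - a ^ 8 * d ^ 4)) /
        (a ^ 8 * b ^ 4 * c ^ 8 * d ^ 4) := by
    simp only
    field_simp
    ring
  rw [factor, hX, hY]
  field_simp
  ring
end

section
/- Let f_{6,6}(z) = η(2z)⁹η(3z)⁹/(η(z)³η(6z)³) + η(z)⁹η(6z)⁹/(η(2z)³η(3z)³) for z in the upper half plane. Then f_{6,6} satisfies the Fricke involution identity f_{6,6}(−1/(6z)) = −216 z⁶ f_{6,6}(z) for all z in the upper half plane. -/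
open scoped BigOperators Real

/-- The Dedekind eta function `η(z) = e^{πiz/12} ∏_{n≥1} (1 - e^{2πinz})`. -/
noncomputable def dedekindEta (z : ℂ) : ℂ :=
  Complex.exp (Real.pi * Complex.I * z / 12) *
    ∏' n : ℕ, (1 - Complex.exp (2 * Real.pi * Complex.I * ((n : ℂ) + 1) * z))

/-- The weight-6 level-6 cusp form
`f_{6,6}(z) = η(2z)⁹η(3z)⁹/(η(z)³η(6z)³) + η(z)⁹η(6z)⁹/(η(2z)³η(3z)³)`. -/
noncomputable def f66 (z : ℂ) : ℂ :=
  dedekindEta (2 * z) ^ 9 * dedekindEta (3 * z) ^ 9 /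
      (dedekindEta z ^ 3 * dedekindEta (6 * z) ^ 3) +
    dedekindEta z ^ 9 * dedekindEta (6 * z) ^ 9 /
      (dedekindEta (2 * z) ^ 3 * dedekindEta (3 * z) ^ 3)

/-- `dedekindEta` agrees with Mathlib's eta function. -/
lemma dedekindEta_eq_eta (z : ℂ) : dedekindEta z = ModularForm.eta z := by
  simp only [dedekindEta, ModularForm.eta, ModularForm.eta_q_eq_cexp]
  congr 1
  simp only [Function.Periodic.qParam]
  push_cast
  congr 1
  ring

lemma dedekindEta_ne_zero {z : ℂ} (hz : 0 < z.im) : dedekindEta z ≠ 0 := by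
  rw [dedekindEta_eq_eta]
  exact ModularForm.eta_ne_zero hz

lemma complex_sqrt_sq (z : ℂ) : Complex.sqrt z ^ 2 = z := by
  simp [Complex.sqrt]

lemma complex_sqrt_ofReal_mul {k : ℝ} (hk : 0 < k) {z : ℂ} (hz : z ≠ 0) :
    Complex.sqrt (k * z) = (√k : ℝ) * Complex.sqrt z := by
  have hk0 : (k : ℂ) ≠ 0 := Complex.ofReal_ne_zero.mpr hk.ne'
  rw [Complex.sqrt, Complex.sqrt, Complex.cpow_def_of_ne_zero (mul_ne_zero hk0 hz),
    Complex.cpow_def_of_ne_zero hz, Complex.log_ofReal_mul hk hz, add_mul, Complex.exp_add,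
    Real.sqrt_eq_rpow, Real.rpow_def_of_pos hk]
  push_cast
  norm_num

/-- The inversion formula for `η` at a positive real multiple of `z`, with the automorphy factor
split multiplicatively. -/
lemma dedekindEta_neg_inv {k : ℝ} (hk : 0 < k) {z : ℂ} (hz : 0 < z.im) :
    dedekindEta (-1 / (k * z)) =
      (√k : ℝ) * (Complex.sqrt z / Complex.sqrt Complex.I) * dedekindEta (k * z) := by
  have hz0 : z ≠ 0 := by
    rintro rfl
    simp at hz
  have hkz : (k * z : ℂ) ∈ UpperHalfPlane.upperHalfPlaneSet := by
    simpa [UpperHalfPlane.upperHalfPlaneSet] using mul_pos hk hz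
  have h := ModularForm.eta_comp_eq_csqrt_I_inv hkz
  simp only [Function.comp_apply, Pi.smul_apply, Pi.mul_apply, smul_eq_mul] at h
  rw [dedekindEta_eq_eta, dedekindEta_eq_eta, h, complex_sqrt_ofReal_mul hk hz0]
  ring

/-- Fricke involution identity: `f_{6,6}(-1/(6z)) = -6³z⁶ f_{6,6}(z)` on the upper half plane. -/
theorem f66_fricke (z : ℂ) (hz : 0 < z.im) :
    f66 (-1 / (6 * z)) = -216 * z ^ 6 * f66 z := by
  have hz0 : z ≠ 0 := by
    rintro rfl
    simp at hz
  set u : ℂ := Complex.sqrt z / Complex.sqrt Complex.I with hu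
  have hu4 : u ^ 4 = -z ^ 2 := by
    rw [hu, show (4 : ℕ) = 2 * 2 from rfl, pow_mul, div_pow, complex_sqrt_sq, complex_sqrt_sq,
      div_pow, Complex.I_sq, div_neg, div_one]
  have hu0 : u ≠ 0 := by
    rintro h
    simp [h, hz0] at hu4
  have e1 : dedekindEta (6 * (-1 / (6 * z))) = u * dedekindEta z := by
    have := dedekindEta_neg_inv one_pos hz
    rw [show 6 * (-1 / (6 * z)) = -1 / z by field_simp]
    simpa using this
  have e2 : dedekindEta (3 * (-1 / (6 * z))) = (√2 : ℝ) * u * dedekindEta (2 * z) := by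
    have := dedekindEta_neg_inv two_pos hz
    rw [show 3 * (-1 / (6 * z)) = -1 / (2 * z) by field_simp; norm_num]
    simpa using this
  have e3 : dedekindEta (2 * (-1 / (6 * z))) = (√3 : ℝ) * u * dedekindEta (3 * z) := by
    have := dedekindEta_neg_inv three_pos hz
    rw [show 2 * (-1 / (6 * z)) = -1 / (3 * z) by field_simp; norm_num]
    simpa using this
  have e6 : dedekindEta (-1 / (6 * z)) =
      (√2 : ℝ) * (√3 : ℝ) * u * dedekindEta (6 * z) := by
    have := dedekindEta_neg_inv (k := 2 * 3) (by norm_num) hz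
    rw [Real.sqrt_mul zero_le_two] at this
    push_cast at this
    norm_num at this
    simpa using this
  have h1 : dedekindEta z ≠ 0 := dedekindEta_ne_zero hz
  have h2 : dedekindEta (2 * z) ≠ 0 := dedekindEta_ne_zero (by simpa using hz)
  have h3 : dedekindEta (3 * z) ≠ 0 := dedekindEta_ne_zero (by simpa using hz)
  have h6 : dedekindEta (6 * z) ≠ 0 := dedekindEta_ne_zero (by simpa using hz)
  have s2 : ((√2 : ℝ) : ℂ) ^ 2 = 2 := by
    exact_mod_cast Real.sq_sqrt zero_le_two
  have s3 : ((√3 : ℝ) : ℂ) ^ 2 = 3 := by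
    exact_mod_cast Real.sq_sqrt zero_le_three
  have n2 : ((√2 : ℝ) : ℂ) ≠ 0 := fun h ↦ by simp [h] at s2
  have n3 : ((√3 : ℝ) : ℂ) ≠ 0 := fun h ↦ by simp [h] at s3
  have factor : (-216 : ℂ) * z ^ 6 =
      (((√2 : ℝ) : ℂ) ^ 2) ^ 3 * (((√3 : ℝ) : ℂ) ^ 2) ^ 3 * (u ^ 4) ^ 3 := by
    rw [s2, s3, hu4]
    ring
  rw [factor]
  unfold f66
  rw [e1, e2, e3, e6]
  generalize ((√2 : ℝ) : ℂ) = a at *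
  generalize ((√3 : ℝ) : ℂ) = b at *
  clear_value u
  field_simp
end

section
/- The Bessel moments satisfy M(1,5,1) = (π²/3) · M(3,3,1), i.e. ∫₀^∞ I₀(x) K₀(x)⁵ x dx = (π²/3) ∫₀^∞ I₀(x)³ K₀(x)³ x dx. (This is the statement L₆(2) = (2/π²)M(1,5,1) = (2/3)M(3,3,1) for the critical L-value of the weight-4 level-6 cusp form.) -/
open scoped Real

/-- The modified Bessel function `I₀(x) = (1/π)∫₀^π e^{x cos θ} dθ`. -/
noncomputable def besselI0 (x : ℝ) : ℝ :=
  (1 / π) * ∫ θ in (0 : ℝ)..π, Real.exp (x * Real.cos θ)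

/-- The modified Bessel function `K₀(x) = ∫₀^∞ e^{-x cosh t} dt`. -/
noncomputable def besselK0 (x : ℝ) : ℝ :=
  ∫ t in Set.Ioi (0 : ℝ), Real.exp (-(x * Real.cosh t))

/-- The Bessel moment `M(a,b,c) = ∫₀^∞ I₀(x)^a K₀(x)^b x^c dx`. -/
noncomputable def besselMoment (a b c : ℕ) : ℝ :=
  ∫ x in Set.Ioi (0 : ℝ), besselI0 x ^ a * besselK0 x ^ b * x ^ c

open MeasureTheory Set Filter Topology

/-- The truncated singularity `|v|^(-s)`, `s < 1`, is integrable. -/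
lemma integrable_indicator_abs_rpow {s : ℝ} (hs : s < 1) :
    Integrable ((Icc (-1 : ℝ) 1).indicator fun v : ℝ => |v| ^ (-s)) := by
  rw [integrable_indicator_iff measurableSet_Icc, integrableOn_Icc_iff_integrableOn_Ioc,
    ← intervalIntegrable_iff_integrableOn_Ioc_of_le (by norm_num)]
  have h01 : IntervalIntegrable (fun v : ℝ => |v| ^ (-s)) volume 0 1 := by
    refine (intervalIntegral.intervalIntegrable_rpow' (r := -s) (a := 0) (b := 1)
      (by linarith)).congr fun v hv => ?_
    rw [uIoc_of_le zero_le_one] at hv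
    simp only [abs_of_pos hv.1]
  have h10 : IntervalIntegrable (fun v : ℝ => |v| ^ (-s)) volume (-1) 0 := by
    simpa using (h01.comp_mul_left (c := -1)).symm
  exact h10.trans h01

/-- Weighted integrals of a translated power singularity are bounded uniformly in the
translation. -/
lemma exists_integral_exp_mul_abs_sub_rpow_le {s : ℝ} (hs0 : 0 ≤ s) (hs : s < 1) :
    ∃ C : ℝ, 0 < C ∧ ∀ c : ℝ,
      IntegrableOn (fun u : ℝ => Real.exp (-u) * |u - c| ^ (-s)) (Ioi 0) ∧
      ∫ u in Ioi (0 : ℝ), Real.exp (-u) * |u - c| ^ (-s) ≤ C := by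
  set g : ℝ → ℝ := (Icc (-1 : ℝ) 1).indicator fun v : ℝ => |v| ^ (-s) with hg
  have hgi : Integrable g := integrable_indicator_abs_rpow hs
  have hg0 : ∀ v, 0 ≤ g v := fun v => indicator_nonneg (fun v _ => by positivity) v
  have hexp : IntegrableOn (fun u : ℝ => Real.exp (-u)) (Ioi 0) := integrableOn_exp_neg_Ioi 0
  refine ⟨1 + ∫ v, g v, add_pos_of_pos_of_nonneg one_pos (integral_nonneg hg0), fun c => ?_⟩
  have hgc : Integrable (fun u => g (u - c)) := hgi.comp_sub_right c
  have hle : ∀ u ∈ Ioi (0 : ℝ),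
      Real.exp (-u) * |u - c| ^ (-s) ≤ Real.exp (-u) + g (u - c) := by
    intro u hu
    have he : Real.exp (-u) ≤ 1 := Real.exp_le_one_iff.2 (by linarith [mem_Ioi.1 hu])
    by_cases hv : u - c ∈ Icc (-1 : ℝ) 1
    · have : g (u - c) = |u - c| ^ (-s) := indicator_of_mem hv _
      rw [this]
      nlinarith [Real.exp_pos (-u), Real.rpow_nonneg (abs_nonneg (u - c)) (-s)]
    · have h1 : 1 ≤ |u - c| := by
        by_contra h
        exact hv (abs_le.1 (not_le.1 h).le)
      have : |u - c| ^ (-s) ≤ 1 := Real.rpow_le_one_of_one_le_of_nonpos h1 (by linarith)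
      nlinarith [Real.exp_pos (-u), hg0 (u - c)]
  have hsum := hexp.add hgc.integrableOn
  have hint : IntegrableOn (fun u : ℝ => Real.exp (-u) * |u - c| ^ (-s)) (Ioi 0) := by
    refine Integrable.mono' hsum (by fun_prop) ?_
    filter_upwards [ae_restrict_mem measurableSet_Ioi] with u hu
    rw [Real.norm_of_nonneg (by positivity)]
    exact hle u hu
  refine ⟨hint, ?_⟩
  calc _ ≤ ∫ u in Ioi (0 : ℝ), (Real.exp (-u) + g (u - c)) :=
        setIntegral_mono_on hint hsum measurableSet_Ioi hle
    _ = 1 + ∫ u in Ioi (0 : ℝ), g (u - c) := by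
        rw [integral_add hexp hgc.integrableOn, integral_exp_neg_Ioi_zero]
    _ ≤ 1 + ∫ u, g (u - c) := by
        refine add_le_add le_rfl ?_
        exact setIntegral_le_integral hgc (ae_of_all _ fun u => hg0 _)
    _ = 1 + ∫ v, g v := by rw [integral_sub_right_eq_self]

/-- The density `e^{-u} u^{-1/2}`. -/
noncomputable def gammaWeight (u : ℝ) : ℝ := Real.exp (-u) * u ^ (-(1 / 2) : ℝ)

/-- The majorant `∫₀^∞ e^{-u} u^{-1/2} |u - 2x|^{-1/2} du`. -/
noncomputable def kernelMajorant (x : ℝ) : ℝ :=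
  ∫ u in Ioi (0 : ℝ), gammaWeight u * |u - 2 * x| ^ (-(1 / 2) : ℝ)

lemma gammaWeight_nonneg {u : ℝ} (hu : 0 ≤ u) : 0 ≤ gammaWeight u := by
  unfold gammaWeight; positivity

lemma measurable_gammaWeight : Measurable gammaWeight := by
  unfold gammaWeight; fun_prop

lemma integrableOn_gammaWeight : IntegrableOn gammaWeight (Ioi 0) := by
  obtain ⟨C, -, hC⟩ := exists_integral_exp_mul_abs_sub_rpow_le (s := 1 / 2) (by norm_num)
    (by norm_num)
  refine (hC 0).1.congr_fun (fun u hu => ?_) measurableSet_Ioi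
  simp only [gammaWeight, sub_zero, abs_of_pos (mem_Ioi.1 hu)]

lemma rpow_neg_half_mul_le {s x p q : ℝ} (hs : 1 / 2 ≤ s) (hs1 : s ≤ 1) (hx : 0 < x)
    (hp : x ≤ p) (hq : 0 < q) (hqp : q ≤ p) :
    p ^ (-(1 / 2) : ℝ) * q ^ (-(1 / 2) : ℝ) ≤ x ^ (-(1 - s)) * q ^ (-s) := by
  have hp0 : 0 < p := hx.trans_le hp
  calc p ^ (-(1 / 2) : ℝ) * q ^ (-(1 / 2) : ℝ)
      = p ^ (-(1 - s)) * (p ^ (-(s - 1 / 2)) * q ^ (-(1 / 2) : ℝ)) := by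
        rw [← mul_assoc, ← Real.rpow_add hp0]; ring_nf
    _ ≤ x ^ (-(1 - s)) * (q ^ (-(s - 1 / 2)) * q ^ (-(1 / 2) : ℝ)) := by
        gcongr ?_ * (?_ * _)
        · exact Real.rpow_le_rpow_of_nonpos hx hp (by linarith)
        · exact Real.rpow_le_rpow_of_nonpos hq hqp (by linarith)
    _ = x ^ (-(1 - s)) * q ^ (-s) := by rw [← Real.rpow_add hq]; ring_nf

lemma gammaWeight_mul_le {s x u : ℝ} (hs : 1 / 2 ≤ s) (hs1 : s ≤ 1) (hx : 0 < x) (hu : 0 < u) :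
    gammaWeight u * |u - 2 * x| ^ (-(1 / 2) : ℝ) ≤
      x ^ (-(1 - s)) * (Real.exp (-u) * |u - 0| ^ (-s) + Real.exp (-u) * |u - 2 * x| ^ (-s)) := by
  have key : u ^ (-(1 / 2) : ℝ) * |u - 2 * x| ^ (-(1 / 2) : ℝ) ≤
      x ^ (-(1 - s)) * (u ^ (-s) + |u - 2 * x| ^ (-s)) := by
    have hxs : 0 ≤ x ^ (-(1 - s)) := by positivity
    have h1 : 0 ≤ u ^ (-s) := by positivity
    have h2 : 0 ≤ |u - 2 * x| ^ (-s) := by positivity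
    rcases eq_or_ne (u - 2 * x) 0 with h0 | h0
    · rw [h0, abs_zero, Real.zero_rpow (by norm_num : (-(1 / 2) : ℝ) ≠ 0), mul_zero]
      positivity
    have hv : 0 < |u - 2 * x| := abs_pos.2 h0
    have hsum : 2 * x ≤ u + |u - 2 * x| := by linarith [neg_abs_le (u - 2 * x)]
    rcases le_total u |u - 2 * x| with h | h
    · have := rpow_neg_half_mul_le hs hs1 hx (by linarith : x ≤ |u - 2 * x|) hu h
      rw [mul_comm]
      exact this.trans (by gcongr; linarith)
    · have := rpow_neg_half_mul_le hs hs1 hx (by linarith : x ≤ u) hv h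
      exact this.trans (by gcongr; linarith)
  rw [sub_zero, abs_of_pos hu]
  unfold gammaWeight
  calc _ = Real.exp (-u) * (u ^ (-(1 / 2) : ℝ) * |u - 2 * x| ^ (-(1 / 2) : ℝ)) := by ring
    _ ≤ Real.exp (-u) * (x ^ (-(1 - s)) * (u ^ (-s) + |u - 2 * x| ^ (-s))) := by gcongr
    _ = _ := by ring

lemma integrableOn_kernelMajorant {x : ℝ} (hx : 0 < x) :
    IntegrableOn (fun u => gammaWeight u * |u - 2 * x| ^ (-(1 / 2) : ℝ)) (Ioi 0) := by
  obtain ⟨C, -, hC⟩ := exists_integral_exp_mul_abs_sub_rpow_le (s := 1 / 2) (by norm_num)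
    (by norm_num)
  refine Integrable.mono' (((hC 0).1.add (hC (2 * x)).1).const_mul (x ^ (-(1 - 1 / 2) : ℝ)))
    (by have := measurable_gammaWeight; fun_prop) ?_
  filter_upwards [ae_restrict_mem measurableSet_Ioi] with u hu
  have := gammaWeight_nonneg (mem_Ioi.1 hu).le
  rw [Real.norm_of_nonneg (by positivity)]
  exact gammaWeight_mul_le le_rfl (by norm_num) hx hu

lemma kernelMajorant_nonneg (x : ℝ) : 0 ≤ kernelMajorant x := by
  refine setIntegral_nonneg measurableSet_Ioi fun u hu => ?_
  have := gammaWeight_nonneg (mem_Ioi.1 hu).le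
  positivity

lemma exists_kernelMajorant_le {s : ℝ} (hs : 1 / 2 ≤ s) (hs1 : s < 1) :
    ∃ C : ℝ, 0 < C ∧ ∀ x : ℝ, 0 < x → kernelMajorant x ≤ C * x ^ (-(1 - s)) := by
  obtain ⟨C, hC0, hC⟩ := exists_integral_exp_mul_abs_sub_rpow_le (by linarith : 0 ≤ s) hs1
  refine ⟨2 * C, by positivity, fun x hx => ?_⟩
  have hsum := ((hC 0).1.add (hC (2 * x)).1).const_mul (x ^ (-(1 - s)))
  calc kernelMajorant x ≤ ∫ u in Ioi (0 : ℝ), x ^ (-(1 - s)) *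
        (Real.exp (-u) * |u - 0| ^ (-s) + Real.exp (-u) * |u - 2 * x| ^ (-s)) :=
        setIntegral_mono_on (integrableOn_kernelMajorant hx) hsum measurableSet_Ioi
          fun u hu => gammaWeight_mul_le hs hs1.le hx hu
    _ = x ^ (-(1 - s)) * ((∫ u in Ioi (0 : ℝ), Real.exp (-u) * |u - 0| ^ (-s)) +
          ∫ u in Ioi (0 : ℝ), Real.exp (-u) * |u - 2 * x| ^ (-s)) := by
        rw [integral_const_mul, integral_add (hC 0).1 (hC (2 * x)).1]
    _ ≤ x ^ (-(1 - s)) * (C + C) := by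
        gcongr
        exacts [(hC 0).2, (hC _).2]
    _ = 2 * C * x ^ (-(1 - s)) := by ring

/-- `e^z K₀(z)`, continued to the plane cut along `(-∞, 0]`, as
`∫₀^∞ e^{-u} u^{-1/2} (u + 2z)^{-1/2} du` with the principal branch. -/
noncomputable def scaledK (z : ℂ) : ℂ :=
  ∫ u in Ioi (0 : ℝ), (gammaWeight u : ℂ) * ((u : ℂ) + 2 * z) ^ ((-(1 / 2) : ℝ) : ℂ)

lemma measurable_scaledK_integrand (z : ℂ) : Measurable fun u : ℝ =>
    (gammaWeight u : ℂ) * ((u : ℂ) + 2 * z) ^ ((-(1 / 2) : ℝ) : ℂ) := by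
  have := measurable_gammaWeight
  fun_prop

lemma norm_scaledK_integrand_le {z : ℂ} {u : ℝ} (hu : 0 < u) (hne : u ≠ 2 * |z.re|) :
    ‖(gammaWeight u : ℂ) * ((u : ℂ) + 2 * z) ^ ((-(1 / 2) : ℝ) : ℂ)‖ ≤
      gammaWeight u * |u - 2 * (|z.re|)| ^ (-(1 / 2) : ℝ) := by
  have hw := gammaWeight_nonneg hu.le
  rw [norm_mul, Complex.norm_cpow_real, Complex.norm_real, Real.norm_of_nonneg hw]
  gcongr ?_ * ?_
  refine Real.rpow_le_rpow_of_nonpos (abs_pos.2 (sub_ne_zero.2 hne)) ?_ (by norm_num)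
  calc |u - 2 * (|z.re|)| ≤ |u + 2 * z.re| := by
        rcases abs_cases z.re with ⟨h, _⟩ | ⟨h, _⟩
        · rw [h]
          exact abs_le.2 ⟨by linarith [le_abs_self (u + 2 * z.re)],
            by linarith [le_abs_self (u + 2 * z.re)]⟩
        · rw [h]
          exact le_of_eq (by ring_nf)
    _ = |((u : ℂ) + 2 * z).re| := by simp
    _ ≤ _ := Complex.abs_re_le_norm _

lemma ae_norm_scaledK_integrand_le (z : ℂ) : ∀ᵐ u : ℝ ∂volume.restrict (Ioi 0),
    ‖(gammaWeight u : ℂ) * ((u : ℂ) + 2 * z) ^ ((-(1 / 2) : ℝ) : ℂ)‖ ≤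
      gammaWeight u * |u - 2 * (|z.re|)| ^ (-(1 / 2) : ℝ) := by
  filter_upwards [ae_restrict_mem measurableSet_Ioi,
    ae_restrict_of_ae (Measure.ae_ne volume (2 * |z.re|))] with u hu hne
  exact norm_scaledK_integrand_le hu hne

lemma norm_scaledK_le_kernelMajorant {z : ℂ} (hz : z.re ≠ 0) :
    ‖scaledK z‖ ≤ kernelMajorant |z.re| :=
  norm_integral_le_of_norm_le (integrableOn_kernelMajorant (abs_pos.2 hz))
    (ae_norm_scaledK_integrand_le z)

lemma abs_im_le_norm_ofReal_add_two_mul (u : ℝ) (z : ℂ) : |z.im| ≤ ‖(u : ℂ) + 2 * z‖ :=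
  calc |z.im| ≤ |((u : ℂ) + 2 * z).im| := by
        simp [abs_mul]; linarith [abs_nonneg z.im]
    _ ≤ _ := Complex.abs_im_le_norm _

lemma norm_scaledK_integrand_le_of_im {z : ℂ} {d u : ℝ} (hd : 0 < d) (hz : d ≤ |z.im|)
    (hu : 0 < u) :
    ‖(gammaWeight u : ℂ) * ((u : ℂ) + 2 * z) ^ ((-(1 / 2) : ℝ) : ℂ)‖ ≤
      gammaWeight u * d ^ (-(1 / 2) : ℝ) := by
  have hw := gammaWeight_nonneg hu.le
  rw [norm_mul, Complex.norm_cpow_real, Complex.norm_real, Real.norm_of_nonneg hw]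
  gcongr ?_ * ?_
  exact Real.rpow_le_rpow_of_nonpos hd (hz.trans (abs_im_le_norm_ofReal_add_two_mul u z))
    (by norm_num)

lemma norm_scaledK_le_of_im_ne_zero {z : ℂ} (hz : z.im ≠ 0) :
    ‖scaledK z‖ ≤ (∫ u in Ioi (0 : ℝ), gammaWeight u) * |z.im| ^ (-(1 / 2) : ℝ) := by
  rw [← integral_mul_const]
  refine norm_integral_le_of_norm_le (integrableOn_gammaWeight.mul_const _) ?_
  filter_upwards [ae_restrict_mem measurableSet_Ioi] with u hu
  exact norm_scaledK_integrand_le_of_im (abs_pos.2 hz) le_rfl hu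

lemma differentiableAt_scaledK {z : ℂ} (hz : z.im ≠ 0) : DifferentiableAt ℂ scaledK z := by
  have hd : 0 < |z.im| / 2 := by positivity
  set d := |z.im| / 2 with hdd
  have him : ∀ w ∈ Metric.ball z d, d ≤ |w.im| := by
    intro w hw
    have h1 : |(w - z).im| < d := (Complex.abs_im_le_norm _).trans_lt (mem_ball_iff_norm.1 hw)
    rw [Complex.sub_im, abs_sub_comm] at h1
    linarith [abs_sub_abs_le_abs_sub z.im w.im]
  refine (hasDerivAt_integral_of_dominated_loc_of_deriv_le (𝕜 := ℂ)
    (F := fun w (u : ℝ) => (gammaWeight u : ℂ) * ((u : ℂ) + 2 * w) ^ ((-(1 / 2) : ℝ) : ℂ))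
    (F' := fun w (u : ℝ) => (gammaWeight u : ℂ) * (((-(1 / 2) : ℝ) : ℂ) *
      ((u : ℂ) + 2 * w) ^ (((-(1 / 2) : ℝ) : ℂ) - 1) * 2))
    (bound := fun u => gammaWeight u * d ^ (-(3 / 2) : ℝ))
    (Metric.ball_mem_nhds z hd) ?_ ?_ ?_ ?_ ?_ ?_).2.differentiableAt
  · exact Eventually.of_forall fun w => (measurable_scaledK_integrand w).aestronglyMeasurable
  · refine Integrable.mono' (integrableOn_gammaWeight.mul_const (d ^ (-(1 / 2) : ℝ)))
      (measurable_scaledK_integrand z).aestronglyMeasurable ?_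
    filter_upwards [ae_restrict_mem measurableSet_Ioi] with u hu
    exact norm_scaledK_integrand_le_of_im hd (him z (Metric.mem_ball_self hd)) hu
  · have := measurable_gammaWeight
    exact Measurable.aestronglyMeasurable (by fun_prop)
  · filter_upwards [ae_restrict_mem measurableSet_Ioi] with u hu w hw
    have hw' := gammaWeight_nonneg (mem_Ioi.1 hu).le
    have hexp : ((-(1 / 2) : ℝ) : ℂ) - 1 = ((-(3 / 2) : ℝ) : ℂ) := by push_cast; norm_num
    rw [hexp, norm_mul, norm_mul, norm_mul, Complex.norm_cpow_real, Complex.norm_real,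
      Complex.norm_real, Real.norm_of_nonneg hw']
    gcongr ?_ * ?_
    have := Real.rpow_le_rpow_of_nonpos hd
      ((him w hw).trans (abs_im_le_norm_ofReal_add_two_mul u w)) (by norm_num : -(3 / 2 : ℝ) ≤ 0)
    norm_num at this ⊢
    linarith
  · exact integrableOn_gammaWeight.mul_const _
  · filter_upwards with u w hw
    have hne : w.im ≠ 0 := abs_pos.1 (hd.trans_le (him w hw))
    have hlin : HasDerivAt (fun w : ℂ => (u : ℂ) + 2 * w) 2 w := by
      simpa using ((hasDerivAt_id w).const_mul 2).const_add (u : ℂ)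
    exact (hlin.cpow_const (Or.inr (by simpa using hne))).const_mul _

lemma scaledK_conj {z : ℂ} (hz : z ∈ Complex.slitPlane) :
    scaledK (starRingEnd ℂ z) = starRingEnd ℂ (scaledK z) := by
  unfold scaledK
  rw [← integral_conj]
  refine setIntegral_congr_fun measurableSet_Ioi fun u hu => ?_
  have hmem : (u : ℂ) + 2 * z ∈ Complex.slitPlane := by
    rw [Complex.mem_slitPlane_iff] at hz ⊢
    rcases hz with h | h
    · left; simp; linarith [mem_Ioi.1 hu]
    · right; simpa using h
  simp only [map_mul, Complex.conj_ofReal]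
  have hpow := Complex.conj_cpow _ ((-(1 / 2) : ℝ) : ℂ) (Complex.slitPlane_arg_ne_pi hmem)
  rw [Complex.conj_ofReal] at hpow
  rw [← hpow, map_add, map_mul, Complex.conj_ofReal, map_ofNat]

/-- `scaledK` is continuous from above at nonzero real points. -/
lemma tendsto_scaledK_add_mul_I {a : ℝ} (ha : a ≠ 0) :
    Tendsto (fun ε : ℝ => scaledK (a + ε * Complex.I)) (𝓝[>] 0) (𝓝 (scaledK a)) := by
  refine tendsto_integral_filter_of_dominated_convergence
    (fun u => gammaWeight u * |u - 2 * (|a|)| ^ (-(1 / 2) : ℝ))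
    (Eventually.of_forall fun ε => (measurable_scaledK_integrand _).aestronglyMeasurable)
    (Eventually.of_forall fun ε => ?_) (integrableOn_kernelMajorant (abs_pos.2 ha)) ?_
  · simpa using ae_norm_scaledK_integrand_le (a + ε * Complex.I)
  · filter_upwards [ae_restrict_of_ae (Measure.ae_ne volume (-2 * a))] with u hu
    refine Tendsto.const_mul _ ?_
    have hv : u + 2 * a ≠ 0 := fun h => hu (by linarith)
    have hlim : Tendsto (fun ε : ℝ => (u : ℂ) + 2 * (a + ε * Complex.I)) (𝓝[>] 0)
        (𝓝[{w : ℂ | 0 ≤ w.im}] ((u : ℂ) + 2 * a)) := by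
      refine tendsto_nhdsWithin_iff.2 ⟨?_, ?_⟩
      · have : Continuous fun ε : ℝ => (u : ℂ) + 2 * (a + ε * Complex.I) := by fun_prop
        simpa using (this.tendsto 0).mono_left nhdsWithin_le_nhds
      · filter_upwards [self_mem_nhdsWithin] with ε hε
        simpa using (mem_Ioi.1 hε).le
    have hlog : ContinuousWithinAt Complex.log {w : ℂ | 0 ≤ w.im} ((u : ℂ) + 2 * a) := by
      rcases lt_or_gt_of_ne hv with h | h
      · exact Complex.continuousWithinAt_log_of_re_neg_of_im_zero (by simpa using h) (by simp)
      · exact (continuousAt_clog (Complex.mem_slitPlane_iff.2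
          (Or.inl (by simpa using h)))).continuousWithinAt
    have h0 : (u : ℂ) + 2 * a ≠ 0 := by exact_mod_cast hv
    have hpow : ContinuousWithinAt (fun w : ℂ => w ^ ((-(1 / 2) : ℝ) : ℂ)) {w : ℂ | 0 ≤ w.im}
        ((u : ℂ) + 2 * a) := by
      refine ((hlog.mul_const _).cexp).congr_of_eventuallyEq ?_ (Complex.cpow_def_of_ne_zero h0 _)
      filter_upwards [mem_nhdsWithin_of_mem_nhds (isOpen_ne.mem_nhds h0)] with w hw
      exact Complex.cpow_def_of_ne_zero hw _
    exact hpow.tendsto.comp hlim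

lemma rpow_neg_half_mul_rpow_neg_half {p q r : ℝ} (hp : 0 ≤ p) (hq : 0 ≤ q) (hr : 0 ≤ r)
    (h : p * q = r ^ 2) : p ^ (-(1 / 2) : ℝ) * q ^ (-(1 / 2) : ℝ) = r⁻¹ := by
  rw [← Real.mul_rpow hp hq, h, ← Real.rpow_natCast, ← Real.rpow_mul hr]
  norm_num [Real.rpow_neg_one]

lemma image_mul_cosh_add {x : ℝ} (hx : 0 < x) (c : ℝ) :
    (fun t => x * (Real.cosh t + c)) '' Ioi 0 = Ioi (x * (1 + c)) := by
  ext y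
  constructor
  · rintro ⟨t, ht, rfl⟩
    have := Real.one_lt_cosh.2 (ne_of_gt (mem_Ioi.1 ht))
    exact mem_Ioi.2 (mul_lt_mul_of_pos_left (by linarith) hx)
  · intro hy
    have h1 : 1 < y / x - c := by
      rw [lt_sub_iff_add_lt, lt_div_iff₀ hx, mul_comm]; exact hy
    refine ⟨Real.arcosh (y / x - c), Real.arcosh_pos h1, ?_⟩
    simp only [Real.cosh_arcosh h1.le]
    field_simp
    ring

lemma integral_Ioi_comp_mul_cosh_add {x : ℝ} (hx : 0 < x) (c : ℝ) (g : ℝ → ℝ) :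
    ∫ u in Ioi (x * (1 + c)), g u =
      ∫ t in Ioi (0 : ℝ), x * Real.sinh t * g (x * (Real.cosh t + c)) := by
  have hinj : InjOn (fun t => x * (Real.cosh t + c)) (Ioi 0) := by
    intro s hs t ht hst
    have h : Real.cosh s = Real.cosh t := by
      have := mul_left_cancel₀ hx.ne' hst
      linarith
    exact Real.cosh_strictMonoOn.injOn (mem_Ici.2 (mem_Ioi.1 hs).le)
      (mem_Ici.2 (mem_Ioi.1 ht).le) h
  rw [← image_mul_cosh_add hx c, integral_image_eq_integral_abs_deriv_smul measurableSet_Ioi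
    (f' := fun t => x * Real.sinh t)
    (fun t _ => (((Real.hasDerivAt_cosh t).add_const c).const_mul x).hasDerivWithinAt) hinj]
  refine setIntegral_congr_fun measurableSet_Ioi fun t ht => ?_
  have : 0 < Real.sinh t := Real.sinh_pos_iff.2 ht
  simp only [smul_eq_mul]
  rw [abs_of_pos (by positivity)]

lemma image_mul_one_sub_cos {x : ℝ} (hx : 0 < x) :
    (fun t => x * (1 - Real.cos t)) '' Ioo 0 π = Ioo 0 (2 * x) := by
  ext y
  constructor
  · rintro ⟨t, ht, rfl⟩
    have h1 : Real.cos t < Real.cos 0 :=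
      Real.strictAntiOn_cos ⟨le_rfl, Real.pi_pos.le⟩ ⟨ht.1.le, ht.2.le⟩ ht.1
    have h2 : Real.cos π < Real.cos t :=
      Real.strictAntiOn_cos ⟨ht.1.le, ht.2.le⟩ ⟨Real.pi_pos.le, le_rfl⟩ ht.2
    rw [Real.cos_zero] at h1
    rw [Real.cos_pi] at h2
    exact ⟨mul_pos hx (by linarith), by simp only; nlinarith⟩
  · rintro ⟨hy0, hy⟩
    have h1 : 0 < y / x := by positivity
    have h2 : y / x < 2 := by rwa [div_lt_iff₀ hx]
    refine ⟨Real.arccos (1 - y / x), ⟨Real.arccos_pos.2 (by linarith), ?_⟩, ?_⟩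
    · refine lt_of_le_of_ne (Real.arccos_le_pi _) fun h => ?_
      rw [Real.arccos_eq_pi] at h
      linarith
    · simp only [Real.cos_arccos (by linarith : -1 ≤ 1 - y / x) (by linarith)]
      field_simp
      ring

lemma integral_Ioo_comp_mul_one_sub_cos {x : ℝ} (hx : 0 < x) (g : ℝ → ℝ) :
    ∫ u in Ioo 0 (2 * x), g u =
      ∫ t in Ioo (0 : ℝ) π, x * Real.sin t * g (x * (1 - Real.cos t)) := by
  have hinj : InjOn (fun t => x * (1 - Real.cos t)) (Ioo 0 π) := by
    intro s hs t ht hst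
    have h : Real.cos s = Real.cos t := by
      have := mul_left_cancel₀ hx.ne' hst
      linarith
    exact Real.injOn_cos ⟨hs.1.le, hs.2.le⟩ ⟨ht.1.le, ht.2.le⟩ h
  rw [← image_mul_one_sub_cos hx, integral_image_eq_integral_abs_deriv_smul measurableSet_Ioo
    (f' := fun t => x * Real.sin t)
    (fun t _ => by
      simpa using (((Real.hasDerivAt_cos t).const_sub 1).const_mul x).hasDerivWithinAt) hinj]
  refine setIntegral_congr_fun measurableSet_Ioo fun t ht => ?_
  have : 0 < Real.sin t := Real.sin_pos_of_mem_Ioo ht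
  simp only [smul_eq_mul]
  rw [abs_of_pos (by positivity)]

lemma integral_gammaWeight_mul_add {x : ℝ} (hx : 0 < x) :
    ∫ u in Ioi (0 : ℝ), gammaWeight u * (u + 2 * x) ^ (-(1 / 2) : ℝ) =
      Real.exp x * besselK0 x := by
  have h := integral_Ioi_comp_mul_cosh_add hx (-1)
    (fun u => gammaWeight u * (u + 2 * x) ^ (-(1 / 2) : ℝ))
  rw [add_neg_cancel, mul_zero] at h
  rw [h, besselK0, ← integral_const_mul]
  refine setIntegral_congr_fun measurableSet_Ioi fun t ht => ?_
  have hs : 0 < x * Real.sinh t := mul_pos hx (Real.sinh_pos_iff.2 ht)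
  have hc := Real.one_le_cosh t
  have hprod := rpow_neg_half_mul_rpow_neg_half (p := x * (Real.cosh t + -1))
    (q := x * (Real.cosh t + -1) + 2 * x) (r := x * Real.sinh t)
    (mul_nonneg hx.le (by linarith)) (by nlinarith) hs.le
    (by rw [mul_pow, Real.sinh_sq]; ring)
  have hexp : Real.exp (-(x * (Real.cosh t + -1))) =
      Real.exp x * Real.exp (-(x * Real.cosh t)) := by
    rw [← Real.exp_add]; ring_nf
  simp only [gammaWeight]
  rw [mul_assoc (Real.exp _), hprod, hexp, mul_comm, mul_assoc _ _ (x * _),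
    inv_mul_cancel₀ hs.ne', mul_one]

lemma integral_gammaWeight_mul_sub {x : ℝ} (hx : 0 < x) :
    ∫ u in Ioi (2 * x), gammaWeight u * (u - 2 * x) ^ (-(1 / 2) : ℝ) =
      Real.exp (-x) * besselK0 x := by
  have h := integral_Ioi_comp_mul_cosh_add hx 1
    (fun u => gammaWeight u * (u - 2 * x) ^ (-(1 / 2) : ℝ))
  rw [one_add_one_eq_two, mul_comm x 2] at h
  rw [h, besselK0, ← integral_const_mul]
  refine setIntegral_congr_fun measurableSet_Ioi fun t ht => ?_
  have hs : 0 < x * Real.sinh t := mul_pos hx (Real.sinh_pos_iff.2 ht)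
  have hc := Real.one_le_cosh t
  have hprod := rpow_neg_half_mul_rpow_neg_half (p := x * (Real.cosh t + 1))
    (q := x * (Real.cosh t + 1) - 2 * x) (r := x * Real.sinh t)
    (by positivity) (by nlinarith) hs.le (by rw [mul_pow, Real.sinh_sq]; ring)
  have hexp : Real.exp (-(x * (Real.cosh t + 1))) =
      Real.exp (-x) * Real.exp (-(x * Real.cosh t)) := by
    rw [← Real.exp_add]; ring_nf
  simp only [gammaWeight]
  rw [mul_assoc (Real.exp _), hprod, hexp, mul_comm, mul_assoc _ _ (x * _),
    inv_mul_cancel₀ hs.ne', mul_one]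

lemma integral_gammaWeight_mul_rev {x : ℝ} (hx : 0 < x) :
    ∫ u in Ioo 0 (2 * x), gammaWeight u * (2 * x - u) ^ (-(1 / 2) : ℝ) =
      Real.exp (-x) * (π * besselI0 x) := by
  rw [integral_Ioo_comp_mul_one_sub_cos hx, besselI0, ← mul_assoc π, mul_one_div_cancel
    Real.pi_ne_zero, one_mul, intervalIntegral.integral_of_le Real.pi_pos.le,
    integral_Ioc_eq_integral_Ioo, ← integral_const_mul]
  refine setIntegral_congr_fun measurableSet_Ioo fun t ht => ?_
  have hs : 0 < x * Real.sin t := mul_pos hx (Real.sin_pos_of_mem_Ioo ht)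
  have hc := Real.cos_le_one t
  have hc' := Real.neg_one_le_cos t
  have hprod := rpow_neg_half_mul_rpow_neg_half (p := x * (1 - Real.cos t))
    (q := 2 * x - x * (1 - Real.cos t)) (r := x * Real.sin t)
    (mul_nonneg hx.le (by linarith)) (by nlinarith) hs.le (by rw [mul_pow, Real.sin_sq]; ring)
  have hexp : Real.exp (-(x * (1 - Real.cos t))) =
      Real.exp (-x) * Real.exp (x * Real.cos t) := by
    rw [← Real.exp_add]; ring_nf
  simp only [gammaWeight]
  rw [mul_assoc (Real.exp _), hprod, hexp, mul_comm, mul_assoc _ _ (x * _),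
    inv_mul_cancel₀ hs.ne', mul_one]

lemma scaledK_ofReal {x : ℝ} (hx : 0 < x) :
    scaledK x = ((Real.exp x * besselK0 x : ℝ) : ℂ) := by
  rw [← integral_gammaWeight_mul_add hx, ← integral_complex_ofReal, scaledK]
  refine setIntegral_congr_fun measurableSet_Ioi fun u hu => ?_
  have hpos : 0 ≤ u + 2 * x := by linarith [mem_Ioi.1 hu]
  simp only [Complex.ofReal_mul, Complex.ofReal_cpow hpos]
  push_cast
  ring

lemma scaledK_neg_ofReal {x : ℝ} (hx : 0 < x) :
    scaledK (-x) = ((Real.exp (-x) * besselK0 x : ℝ) : ℂ) -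
      ((Real.exp (-x) * (π * besselI0 x) : ℝ) : ℂ) * Complex.I := by
  have hint : IntegrableOn (fun u : ℝ =>
      (gammaWeight u : ℂ) * ((u : ℂ) + 2 * (-x)) ^ ((-(1 / 2) : ℝ) : ℂ)) (Ioi 0) := by
    refine Integrable.mono' (integrableOn_kernelMajorant hx)
      (measurable_scaledK_integrand (-x)).aestronglyMeasurable ?_
    simpa [abs_of_pos hx] using ae_norm_scaledK_integrand_le (-x)
  have hunion : Ioi (0 : ℝ) = Ioc 0 (2 * x) ∪ Ioi (2 * x) :=
    (Ioc_union_Ioi_eq_Ioi (by positivity)).symm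
  have hexp : Complex.exp (π * Complex.I * ((-(1 / 2) : ℝ) : ℂ)) = -Complex.I := by
    rw [← Complex.exp_neg_pi_div_two_mul_I]
    push_cast
    ring_nf
  rw [scaledK, hunion, setIntegral_union (Ioc_disjoint_Ioi le_rfl) measurableSet_Ioi
    (hint.mono_set Ioc_subset_Ioi_self)
    (hint.mono_set (Ioi_subset_Ioi (by positivity))), integral_Ioc_eq_integral_Ioo,
    ← integral_gammaWeight_mul_rev hx, ← integral_gammaWeight_mul_sub hx, ← integral_complex_ofReal,
    ← integral_complex_ofReal, add_comm, sub_eq_add_neg, ← mul_neg, ← integral_mul_const]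
  congr 1
  · refine setIntegral_congr_fun measurableSet_Ioi fun u hu => ?_
    have hpos : 0 ≤ u - 2 * x := by linarith [mem_Ioi.1 hu]
    simp only [Complex.ofReal_mul, Complex.ofReal_cpow hpos]
    push_cast
    ring_nf
  · refine setIntegral_congr_fun measurableSet_Ioo fun u hu => ?_
    have hneg : u + 2 * -x ≤ 0 := by linarith [hu.2]
    have hpos : 0 ≤ 2 * x - u := by linarith [hu.2]
    have hpow := Complex.ofReal_cpow_of_nonpos hneg ((-(1 / 2) : ℝ) : ℂ)
    rw [hexp] at hpow
    simp only [Complex.ofReal_mul, Complex.ofReal_cpow hpos]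
    push_cast at hpow ⊢
    rw [hpow]
    ring_nf

/-- `z K₀(z)³ K₀(-z)³` on the open half planes; the exponential factors cancel. -/
noncomputable def wickIntegrand (z : ℂ) : ℂ := z * scaledK z ^ 3 * scaledK (-z) ^ 3

lemma differentiableAt_wickIntegrand {z : ℂ} (hz : z.im ≠ 0) :
    DifferentiableAt ℂ wickIntegrand z := by
  have h1 := differentiableAt_scaledK hz
  have h2 : DifferentiableAt ℂ (fun w => scaledK (-w)) z :=
    DifferentiableAt.comp (f := fun w : ℂ => -w) z
      (differentiableAt_scaledK (by simpa using hz)) differentiableAt_id.neg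
  exact (differentiableAt_id.mul (h1.pow 3)).mul (h2.pow 3)

lemma norm_wickIntegrand_le {z : ℂ} {c : ℝ} (h1 : ‖scaledK z‖ ≤ c) (h2 : ‖scaledK (-z)‖ ≤ c) :
    ‖wickIntegrand z‖ ≤ ‖z‖ * c ^ 6 := by
  have hc : 0 ≤ c := (norm_nonneg _).trans h1
  rw [wickIntegrand, norm_mul, norm_mul, norm_pow, norm_pow]
  calc _ ≤ ‖z‖ * c ^ 3 * c ^ 3 := by gcongr
    _ = _ := by ring

lemma norm_wickIntegrand_le_kernelMajorant {z : ℂ} (hz : z.re ≠ 0) :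
    ‖wickIntegrand z‖ ≤ ‖z‖ * kernelMajorant |z.re| ^ 6 :=
  norm_wickIntegrand_le (norm_scaledK_le_kernelMajorant hz)
    (by simpa using norm_scaledK_le_kernelMajorant (z := -z) (by simpa using hz))

lemma norm_wickIntegrand_le_of_im_ne_zero {z : ℂ} (hz : z.im ≠ 0) :
    ‖wickIntegrand z‖ ≤
      ‖z‖ * ((∫ u in Ioi (0 : ℝ), gammaWeight u) * |z.im| ^ (-(1 / 2) : ℝ)) ^ 6 :=
  norm_wickIntegrand_le (norm_scaledK_le_of_im_ne_zero hz)
    (by simpa using norm_scaledK_le_of_im_ne_zero (z := -z) (by simpa using hz))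

lemma rpow_neg_half_pow_six {R : ℝ} (hR : 0 < R) : (R ^ (-(1 / 2) : ℝ)) ^ 6 = (R ^ 3)⁻¹ := by
  rw [← Real.rpow_natCast, ← Real.rpow_mul hR.le, ← Real.rpow_natCast, ← Real.rpow_neg hR.le]
  norm_num

/-- Decay of the integrand on the two far sides of the square contour. -/
lemma exists_norm_wickIntegrand_le :
    ∃ C : ℝ, 0 < C ∧ ∀ R : ℝ, 0 < R → ∀ z : ℂ, |z.re| ≤ R → |z.im| ≤ R →
      (|z.re| = R ∨ |z.im| = R) → ‖wickIntegrand z‖ ≤ C / R ^ 2 := by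
  obtain ⟨C₁, hC₁, h₁⟩ := exists_kernelMajorant_le (s := 1 / 2) le_rfl (by norm_num)
  set C₂ := ∫ u in Ioi (0 : ℝ), gammaWeight u
  refine ⟨2 * (C₁ ^ 6 + C₂ ^ 6), by positivity, fun R hR z hre him hz => ?_⟩
  have hnorm : ‖z‖ ≤ 2 * R := (Complex.norm_le_abs_re_add_abs_im z).trans (by linarith)
  have key : ‖wickIntegrand z‖ ≤ ‖z‖ * ((C₁ ^ 6 + C₂ ^ 6) * (R ^ 3)⁻¹) := by
    rcases hz with h | h
    · refine (norm_wickIntegrand_le_kernelMajorant (by rw [← abs_pos, h]; exact hR)).trans ?_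
      rw [h]
      gcongr
      have := h₁ R hR
      rw [show (-(1 - 1 / 2) : ℝ) = -(1 / 2) by norm_num] at this
      calc kernelMajorant R ^ 6 ≤ (C₁ * R ^ (-(1 / 2) : ℝ)) ^ 6 :=
            pow_le_pow_left₀ (kernelMajorant_nonneg R) this 6
        _ = C₁ ^ 6 * (R ^ 3)⁻¹ := by rw [mul_pow, rpow_neg_half_pow_six hR]
        _ ≤ _ := by gcongr; exact le_add_of_nonneg_right (by positivity)
    · refine (norm_wickIntegrand_le_of_im_ne_zero (by rw [← abs_pos, h]; exact hR)).trans ?_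
      rw [h, mul_pow, rpow_neg_half_pow_six hR]
      gcongr
      exact le_add_of_nonneg_left (by positivity)
  calc _ ≤ ‖z‖ * ((C₁ ^ 6 + C₂ ^ 6) * (R ^ 3)⁻¹) := key
    _ ≤ 2 * R * ((C₁ ^ 6 + C₂ ^ 6) * (R ^ 3)⁻¹) := by gcongr
    _ = _ := by field_simp

lemma exists_integrable_majorant : ∃ b : ℝ → ℝ, IntegrableOn b (Ioi 0) ∧
    ∀ x : ℝ, 0 < x → (x + 1) * kernelMajorant x ^ 6 ≤ b x := by
  obtain ⟨C₁, hC₁, h₁⟩ := exists_kernelMajorant_le (s := 7 / 8) (by norm_num) (by norm_num)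
  obtain ⟨C₂, hC₂, h₂⟩ := exists_kernelMajorant_le (s := 1 / 2) le_rfl (by norm_num)
  refine ⟨fun x => if x ≤ 1 then 2 * C₁ ^ 6 * x ^ (-(3 / 4) : ℝ) else 2 * C₂ ^ 6 * x ^ (-2 : ℝ),
    ?_, fun x hx => ?_⟩
  · rw [← Ioc_union_Ioi_eq_Ioi (zero_le_one (α := ℝ))]
    refine IntegrableOn.union ?_ ?_
    · have h : IntegrableOn (fun x : ℝ => x ^ (-(3 / 4) : ℝ)) (Ioc 0 1) :=
        (intervalIntegrable_iff_integrableOn_Ioc_of_le zero_le_one).1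
          (intervalIntegral.intervalIntegrable_rpow' (by norm_num))
      refine IntegrableOn.congr_fun (h.const_mul (2 * C₁ ^ 6)) (fun x hx => ?_) measurableSet_Ioc
      simp only [if_pos hx.2]
    · have h : IntegrableOn (fun x : ℝ => x ^ (-2 : ℝ)) (Ioi 1) :=
        integrableOn_Ioi_rpow_of_lt (by norm_num) one_pos
      refine IntegrableOn.congr_fun (h.const_mul (2 * C₂ ^ 6)) (fun x hx => ?_) measurableSet_Ioi
      simp only [if_neg (not_le.2 (mem_Ioi.1 hx))]
  · have hk := kernelMajorant_nonneg x
    simp only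
    split_ifs with h
    · calc (x + 1) * kernelMajorant x ^ 6 ≤ 2 * (C₁ * x ^ (-(1 - 7 / 8) : ℝ)) ^ 6 := by
            gcongr
            · linarith
            · exact h₁ x hx
        _ = 2 * C₁ ^ 6 * x ^ (-(3 / 4) : ℝ) := by
            rw [mul_pow, ← Real.rpow_mul_natCast hx.le]
            norm_num [mul_assoc]
    · have h := not_le.1 h
      calc (x + 1) * kernelMajorant x ^ 6 ≤ (2 * x) * (C₂ * x ^ (-(1 - 1 / 2) : ℝ)) ^ 6 := by
            gcongr
            · linarith
            · exact h₂ x hx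
        _ = 2 * C₂ ^ 6 * (x ^ (1 : ℝ) * x ^ (-3 : ℝ)) := by
            rw [mul_pow, ← Real.rpow_mul_natCast hx.le, Real.rpow_one]
            norm_num
            ring
        _ = _ := by rw [← Real.rpow_add hx]; norm_num

lemma wickIntegrand_mul_I {y : ℝ} (hy : y ≠ 0) :
    wickIntegrand (y * Complex.I) =
      Complex.I * ((y * Complex.normSq (scaledK (y * Complex.I)) ^ 3 : ℝ) : ℂ) := by
  have hconj : scaledK (-(y * Complex.I)) = starRingEnd ℂ (scaledK (y * Complex.I)) := by
    rw [← scaledK_conj (Complex.mem_slitPlane_iff.2 (Or.inr (by simpa using hy)))]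
    simp
  rw [wickIntegrand, hconj, mul_assoc, ← mul_pow, Complex.mul_conj]
  push_cast
  ring

lemma norm_wickIntegrand_horizontal_le {b : ℝ → ℝ}
    (hb : ∀ x : ℝ, 0 < x → (x + 1) * kernelMajorant x ^ 6 ≤ b x) {ε : ℝ} (hε : 0 < ε)
    (hε1 : ε ≤ 1) {x : ℝ} (hx : 0 < x) :
    ‖wickIntegrand (x + (-ε : ℝ) * Complex.I)‖ ≤ b x := by
  refine (norm_wickIntegrand_le_kernelMajorant (by simpa using hx.ne')).trans
    (le_trans ?_ (hb x hx))
  have hre : ((x : ℂ) + (-ε : ℝ) * Complex.I).re = x := by simp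
  have him : ((x : ℂ) + (-ε : ℝ) * Complex.I).im = -ε := by simp
  have hn := Complex.norm_le_abs_re_add_abs_im ((x : ℂ) + (-ε : ℝ) * Complex.I)
  rw [hre, him, abs_neg, abs_of_pos hx, abs_of_pos hε] at hn
  rw [hre, abs_of_pos hx]
  gcongr
  linarith

lemma continuous_wickIntegrand_horizontal {ε : ℝ} (hε : 0 < ε) :
    Continuous fun x : ℝ => wickIntegrand (x + (-ε : ℝ) * Complex.I) := by
  refine continuous_iff_continuousAt.2 fun x => ?_
  exact ContinuousAt.comp (f := fun x : ℝ => (x : ℂ) + (-ε : ℝ) * Complex.I)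
    (differentiableAt_wickIntegrand (by simpa using hε.ne')).continuousAt (by fun_prop)

lemma integrableOn_wickIntegrand {ε : ℝ} (hε : 0 < ε) (hε1 : ε ≤ 1) :
    IntegrableOn (fun x : ℝ => wickIntegrand (x + (-ε : ℝ) * Complex.I)) (Ioi 0) := by
  obtain ⟨b, hbi, hb⟩ := exists_integrable_majorant
  refine Integrable.mono' hbi (continuous_wickIntegrand_horizontal hε).aestronglyMeasurable ?_
  filter_upwards [ae_restrict_mem measurableSet_Ioi] with x hx
  exact norm_wickIntegrand_horizontal_le hb hε hε1 hx

lemma abs_im_integral_wickIntegrand_le {C : ℝ} (hC : 0 < C)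
    (hdecay : ∀ R : ℝ, 0 < R → ∀ z : ℂ, |z.re| ≤ R → |z.im| ≤ R →
      (|z.re| = R ∨ |z.im| = R) → ‖wickIntegrand z‖ ≤ C / R ^ 2)
    {ε R : ℝ} (hε : 0 < ε) (hR : ε ≤ R) :
    |(∫ x in (0 : ℝ)..R, wickIntegrand (x + (-ε : ℝ) * Complex.I)).im| ≤ 2 * C / R := by
  have hR0 : 0 < R := hε.trans_le hR
  have hrect := Complex.integral_boundary_rect_eq_zero_of_differentiableOn wickIntegrand
    ⟨0, -ε⟩ ⟨R, -R⟩ (by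
      intro z hz
      refine (differentiableAt_wickIntegrand ?_).differentiableWithinAt
      have := (Complex.mem_reProdIm.1 hz).2
      simp only [uIcc_of_ge (neg_le_neg hR)] at this
      linarith [this.2])
  simp only at hrect
  set B := ∫ x in (0 : ℝ)..R, wickIntegrand (x + (-ε : ℝ) * Complex.I)
  set T := ∫ x in (0 : ℝ)..R, wickIntegrand (x + (-R : ℝ) * Complex.I)
  set V := ∫ y in (-ε)..(-R), wickIntegrand ((R : ℝ) + y * Complex.I)
  have hT : ‖T‖ ≤ C / R := by
    have := intervalIntegral.norm_integral_le_of_norm_le_const (a := 0) (b := R)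
      (f := fun x : ℝ => wickIntegrand (x + (-R : ℝ) * Complex.I)) (C := C / R ^ 2) (by
        intro x hx
        rw [uIoc_of_le hR0.le] at hx
        refine hdecay R hR0 _ ?_ ?_ (Or.inr ?_)
        · simpa [abs_of_pos hx.1] using hx.2
        · simp [abs_of_pos hR0]
        · simp [abs_of_pos hR0])
    refine this.trans (le_of_eq ?_)
    rw [sub_zero, abs_of_pos hR0]
    field_simp
  have hV : ‖V‖ ≤ C / R := by
    have := intervalIntegral.norm_integral_le_of_norm_le_const (a := -ε) (b := -R)
      (f := fun y : ℝ => wickIntegrand ((R : ℝ) + y * Complex.I)) (C := C / R ^ 2) (by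
        intro y hy
        rw [uIoc_of_ge (neg_le_neg hR)] at hy
        refine hdecay R hR0 _ ?_ ?_ (Or.inl ?_)
        · simp [abs_of_pos hR0]
        · simpa using abs_le.2 ⟨hy.1.le, by linarith [hy.2]⟩
        · simp [abs_of_pos hR0])
    refine this.trans ?_
    have hlen : |(-R) - (-ε)| ≤ R := abs_le.2 ⟨by linarith, by linarith⟩
    calc C / R ^ 2 * |(-R) - (-ε)| ≤ C / R ^ 2 * R := by gcongr
      _ = C / R := by field_simp
  have hL : (Complex.I • ∫ y in (-ε)..(-R), wickIntegrand ((0 : ℝ) + y * Complex.I)).im = 0 := by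
    have hcongr : ∫ y in (-ε)..(-R), wickIntegrand ((0 : ℝ) + y * Complex.I) =
        ∫ y in (-ε)..(-R), Complex.I *
          ((y * Complex.normSq (scaledK (y * Complex.I)) ^ 3 : ℝ) : ℂ) := by
      refine intervalIntegral.integral_congr fun y hy => ?_
      rw [uIcc_of_ge (neg_le_neg hR)] at hy
      have hy0 : y ≠ 0 := ne_of_lt (by linarith [hy.2])
      simpa using wickIntegrand_mul_I hy0
    rw [hcongr, intervalIntegral.integral_const_mul, intervalIntegral.integral_ofReal,
      smul_eq_mul, ← mul_assoc, Complex.I_mul_I]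
    simp
  have him : B.im = T.im - (Complex.I • V).im := by
    have := congrArg Complex.im hrect
    rw [Complex.sub_im, Complex.add_im, Complex.sub_im, hL, Complex.zero_im] at this
    linarith
  have hV' : ‖Complex.I • V‖ = ‖V‖ := by simp
  calc |B.im| ≤ |T.im| + |(Complex.I • V).im| := by rw [him]; exact abs_sub _ _
    _ ≤ ‖T‖ + ‖Complex.I • V‖ := add_le_add (Complex.abs_im_le_norm _) (Complex.abs_im_le_norm _)
    _ ≤ C / R + C / R := by rw [hV']; exact add_le_add hT hV
    _ = 2 * C / R := by ring

lemma im_integral_wickIntegrand {ε : ℝ} (hε : 0 < ε) (hε1 : ε ≤ 1) :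
    ∫ x in Ioi (0 : ℝ), (wickIntegrand (x + (-ε : ℝ) * Complex.I)).im = 0 := by
  obtain ⟨C, hC, hdecay⟩ := exists_norm_wickIntegrand_le
  have hint := integrableOn_wickIntegrand hε hε1
  have hlim := (Complex.continuous_im.tendsto _).comp
    (intervalIntegral_tendsto_integral_Ioi 0 hint tendsto_id)
  have hzero : Tendsto (fun R : ℝ =>
      (∫ x in (0 : ℝ)..R, wickIntegrand (x + (-ε : ℝ) * Complex.I)).im) atTop (𝓝 0) := by
    refine squeeze_zero_norm' ?_ (tendsto_const_nhds.div_atTop tendsto_id : Tendsto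
      (fun R : ℝ => 2 * C / R) atTop (𝓝 0))
    filter_upwards [eventually_ge_atTop ε] with R hR
    exact abs_im_integral_wickIntegrand_le hC hdecay hε hR
  exact (integral_im hint).trans (tendsto_nhds_unique hlim hzero)

lemma measurable_besselK0 : Measurable besselK0 :=
  (StronglyMeasurable.integral_prod_right (ν := volume.restrict (Ioi (0 : ℝ)))
    (f := fun x t : ℝ => Real.exp (-(x * Real.cosh t)))
    (by fun_prop : Continuous fun p : ℝ × ℝ =>
      Real.exp (-(p.1 * Real.cosh p.2))).stronglyMeasurable).measurable

lemma measurable_besselI0 : Measurable besselI0 := by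
  unfold besselI0
  simp only [intervalIntegral.integral_of_le Real.pi_pos.le]
  exact (StronglyMeasurable.integral_prod_right (ν := volume.restrict (Ioc (0 : ℝ) π))
    (f := fun x t : ℝ => Real.exp (x * Real.cos t))
    (by fun_prop : Continuous fun p : ℝ × ℝ =>
      Real.exp (p.1 * Real.cos p.2)).stronglyMeasurable).measurable.const_mul _

lemma besselK0_nonneg (x : ℝ) : 0 ≤ besselK0 x :=
  integral_nonneg fun _ => (Real.exp_pos _).le

lemma besselI0_nonneg (x : ℝ) : 0 ≤ besselI0 x :=
  mul_nonneg (by positivity)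
    (intervalIntegral.integral_nonneg Real.pi_pos.le fun _ _ => (Real.exp_pos _).le)

lemma exp_mul_besselK0_le {x : ℝ} (hx : 0 < x) :
    Real.exp x * besselK0 x ≤ kernelMajorant x := by
  have h := norm_scaledK_le_kernelMajorant (z := x) (by simpa using hx.ne')
  rw [scaledK_ofReal hx, Complex.norm_real, Complex.ofReal_re, abs_of_pos hx] at h
  exact (le_abs_self _).trans h

lemma exp_neg_mul_besselK0_le {x : ℝ} (hx : 0 < x) :
    Real.exp (-x) * besselK0 x ≤ kernelMajorant x := by
  refine le_trans ?_ (exp_mul_besselK0_le hx)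
  have := besselK0_nonneg x
  gcongr
  linarith

lemma exp_neg_mul_besselI0_le {x : ℝ} (hx : 0 < x) :
    Real.exp (-x) * besselI0 x ≤ kernelMajorant x := by
  have h := norm_scaledK_le_kernelMajorant (z := -x) (by simpa using hx.ne')
  have him : (scaledK (-x)).im = -(Real.exp (-x) * (π * besselI0 x)) := by
    rw [scaledK_neg_ofReal hx, Complex.sub_im, Complex.im_ofReal_mul, Complex.ofReal_im]
    simp
  have h' := (Complex.abs_im_le_norm _).trans h
  rw [him, abs_neg, Complex.neg_re, Complex.ofReal_re, abs_neg, abs_of_pos hx] at h'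
  refine le_trans ?_ ((le_abs_self _).trans h')
  gcongr
  exact le_mul_of_one_le_left (besselI0_nonneg x) (by linarith [Real.pi_gt_three])

lemma integrableOn_of_le_kernelMajorant {f : ℝ → ℝ} (hf : Measurable f)
    (hle : ∀ x : ℝ, 0 < x → |f x| ≤ x * kernelMajorant x ^ 6) : IntegrableOn f (Ioi 0) := by
  obtain ⟨b, hbi, hb⟩ := exists_integrable_majorant
  refine Integrable.mono' hbi hf.aestronglyMeasurable ?_
  filter_upwards [ae_restrict_mem measurableSet_Ioi] with x hx
  refine (hle x hx).trans (le_trans ?_ (hb x hx))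
  have := kernelMajorant_nonneg x
  gcongr
  linarith

lemma exp_mul_exp_neg (x : ℝ) : Real.exp x * Real.exp (-x) = 1 := by
  rw [← Real.exp_add, add_neg_cancel, Real.exp_zero]

lemma integrableOn_besselI0_mul_besselK0_pow_five :
    IntegrableOn (fun x => besselI0 x ^ 1 * besselK0 x ^ 5 * x ^ 1) (Ioi 0) := by
  have hI := measurable_besselI0
  have hK := measurable_besselK0
  refine integrableOn_of_le_kernelMajorant (by fun_prop) fun x hx => ?_
  have hI0 := besselI0_nonneg x
  have hK0 := besselK0_nonneg x
  have hk := kernelMajorant_nonneg x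
  rw [abs_of_nonneg (by positivity)]
  calc besselI0 x ^ 1 * besselK0 x ^ 5 * x ^ 1
      = x * ((Real.exp (-x) * besselI0 x) * (Real.exp x * besselK0 x) ^ 3 *
          (Real.exp (-x) * besselK0 x) ^ 2) := by
        calc _ = x * (besselI0 x * besselK0 x ^ 5) * (Real.exp x * Real.exp (-x)) ^ 3 := by
              rw [exp_mul_exp_neg]; ring
          _ = _ := by ring
    _ ≤ x * (kernelMajorant x * kernelMajorant x ^ 3 * kernelMajorant x ^ 2) := by
        gcongr
        exacts [exp_neg_mul_besselI0_le hx, exp_mul_besselK0_le hx, exp_neg_mul_besselK0_le hx]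
    _ = _ := by ring

lemma integrableOn_besselI0_pow_three_mul_besselK0_pow_three :
    IntegrableOn (fun x => besselI0 x ^ 3 * besselK0 x ^ 3 * x ^ 1) (Ioi 0) := by
  have hI := measurable_besselI0
  have hK := measurable_besselK0
  refine integrableOn_of_le_kernelMajorant (by fun_prop) fun x hx => ?_
  have hI0 := besselI0_nonneg x
  have hK0 := besselK0_nonneg x
  have hk := kernelMajorant_nonneg x
  rw [abs_of_nonneg (by positivity)]
  calc besselI0 x ^ 3 * besselK0 x ^ 3 * x ^ 1
      = x * ((Real.exp (-x) * besselI0 x) ^ 3 * (Real.exp x * besselK0 x) ^ 3) := by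
        calc _ = x * (besselI0 x ^ 3 * besselK0 x ^ 3) * (Real.exp x * Real.exp (-x)) ^ 3 := by
              rw [exp_mul_exp_neg]; ring
          _ = _ := by ring
    _ ≤ x * (kernelMajorant x ^ 3 * kernelMajorant x ^ 3) := by
        gcongr
        exacts [exp_neg_mul_besselI0_le hx, exp_mul_besselK0_le hx]
    _ = _ := by ring

/-- The boundary values of `wickIntegrand` from below the positive real axis. -/
lemma tendsto_wickIntegrand {x : ℝ} (hx : 0 < x) :
    Tendsto (fun ε : ℝ => wickIntegrand (x + (-ε : ℝ) * Complex.I)) (𝓝[>] 0)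
      (𝓝 (x * (besselK0 x : ℂ) ^ 3 * (besselK0 x - (π * besselI0 x : ℝ) * Complex.I) ^ 3)) := by
  have h1 : Tendsto (fun ε : ℝ => scaledK (x + (-ε : ℝ) * Complex.I)) (𝓝[>] 0)
      (𝓝 (scaledK x)) := by
    have h := (Complex.continuous_conj.tendsto _).comp (tendsto_scaledK_add_mul_I hx.ne')
    rw [← scaledK_conj (Complex.mem_slitPlane_iff.2 (Or.inl (by simpa using hx))),
      Complex.conj_ofReal] at h
    refine h.congr fun ε => ?_
    rw [Function.comp_apply,
      ← scaledK_conj (Complex.mem_slitPlane_iff.2 (Or.inl (by simpa using hx)))]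
    simp
  have h2 : Tendsto (fun ε : ℝ => scaledK (-(x + (-ε : ℝ) * Complex.I))) (𝓝[>] 0)
      (𝓝 (scaledK (-x))) := by
    have h := tendsto_scaledK_add_mul_I (neg_ne_zero.2 hx.ne')
    rw [Complex.ofReal_neg] at h
    refine h.congr fun ε => ?_
    congr 1
    push_cast
    ring
  have h0 : Tendsto (fun ε : ℝ => (x : ℂ) + (-ε : ℝ) * Complex.I) (𝓝[>] 0) (𝓝 x) := by
    have : Continuous fun ε : ℝ => (x : ℂ) + (-ε : ℝ) * Complex.I := by fun_prop
    simpa using (this.tendsto 0).mono_left nhdsWithin_le_nhds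
  have hval : (x : ℂ) * scaledK x ^ 3 * scaledK (-x) ^ 3 =
      x * (besselK0 x : ℂ) ^ 3 * (besselK0 x - (π * besselI0 x : ℝ) * Complex.I) ^ 3 := by
    have he : (Real.exp x : ℂ) * (Real.exp (-x) : ℂ) = 1 := by exact_mod_cast exp_mul_exp_neg x
    rw [scaledK_ofReal hx, scaledK_neg_ofReal hx]
    simp only [Complex.ofReal_mul]
    calc _ = ((Real.exp x : ℂ) * (Real.exp (-x) : ℂ)) ^ 3 *
        (x * (besselK0 x : ℂ) ^ 3 * (besselK0 x - (π * besselI0 x) * Complex.I) ^ 3) := by ring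
      _ = _ := by rw [he]; ring
  rw [← hval]
  exact (h0.mul (h1.pow 3)).mul (h2.pow 3)

lemma im_wickIntegrand_boundary (x a b : ℝ) :
    ((x : ℂ) * (a : ℂ) ^ 3 * (a - (π * b : ℝ) * Complex.I) ^ 3).im =
      π ^ 3 * (b ^ 3 * a ^ 3 * x ^ 1) - 3 * π * (b ^ 1 * a ^ 5 * x ^ 1) := by
  have : (x : ℂ) * (a : ℂ) ^ 3 * (a - (π * b : ℝ) * Complex.I) ^ 3 =
      ((x * a ^ 3 * (a ^ 3 - 3 * a * (π * b) ^ 2) : ℝ) : ℂ) +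
      ((π ^ 3 * (b ^ 3 * a ^ 3 * x ^ 1) - 3 * π * (b ^ 1 * a ^ 5 * x ^ 1) : ℝ) : ℂ) *
        Complex.I := by
    push_cast
    linear_combination ((x : ℂ) * a ^ 3 * (3 * a * (π * b) ^ 2 - (π * b) ^ 3 * Complex.I)) *
      Complex.I_sq
  rw [this]
  simp [-Complex.ofReal_mul, -Complex.ofReal_sub, -Complex.ofReal_pow]

/-- `M(1,5,1) = (π²/3)·M(3,3,1)`. -/
theorem bessel_moment_M151 :
    besselMoment 1 5 1 = (π ^ 2 / 3) * besselMoment 3 3 1 := by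
  obtain ⟨b, hbi, hb⟩ := exists_integrable_majorant
  have hev : ∀ᶠ ε : ℝ in 𝓝[>] 0, 0 < ε ∧ ε ≤ 1 := by
    filter_upwards [Ioc_mem_nhdsGT (zero_lt_one (α := ℝ))] with ε hε using hε
  have hlim : Tendsto (fun ε : ℝ =>
      ∫ x in Ioi (0 : ℝ), (wickIntegrand (x + (-ε : ℝ) * Complex.I)).im) (𝓝[>] 0)
      (𝓝 (∫ x in Ioi (0 : ℝ), (π ^ 3 * (besselI0 x ^ 3 * besselK0 x ^ 3 * x ^ 1) -
        3 * π * (besselI0 x ^ 1 * besselK0 x ^ 5 * x ^ 1)))) := by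
    refine tendsto_integral_filter_of_dominated_convergence b ?_ ?_ hbi ?_
    · filter_upwards [hev] with ε hε
      exact (Complex.continuous_im.comp
        (continuous_wickIntegrand_horizontal hε.1)).aestronglyMeasurable
    · filter_upwards [hev] with ε hε
      filter_upwards [ae_restrict_mem measurableSet_Ioi] with x hx
      exact (Complex.abs_im_le_norm _).trans (norm_wickIntegrand_horizontal_le hb hε.1 hε.2 hx)
    · filter_upwards [ae_restrict_mem measurableSet_Ioi] with x hx
      rw [← im_wickIntegrand_boundary]
      exact (Complex.continuous_im.tendsto _).comp (tendsto_wickIntegrand hx)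
  have hzero := tendsto_nhds_unique hlim (tendsto_const_nhds.congr' (by
    filter_upwards [hev] with ε hε using (im_integral_wickIntegrand hε.1 hε.2).symm))
  rw [integral_sub (integrableOn_besselI0_pow_three_mul_besselK0_pow_three.const_mul _)
    (integrableOn_besselI0_mul_besselK0_pow_five.const_mul _), integral_const_mul,
    integral_const_mul] at hzero
  change π ^ 3 * besselMoment 3 3 1 - 3 * π * besselMoment 1 5 1 = 0 at hzero
  have hpi := Real.pi_ne_zero
  field_simp
  refine mul_left_cancel₀ hpi ?_
  linear_combination -hzero
end

section
/- The Bessel moments satisfy M(1,7,1) = π² · M(3,5,1), i.e. ∫₀^∞ I₀(x) K₀(x)⁷ x dx = π² ∫₀^∞ I₀(x)³ K₀(x)⁵ x dx. (This is the statement L₈(4) = (4/(9π²))M(1,7,1) = (4/9)M(3,5,1) for the critical L-value of the weight-6 level-6 cusp form.) -/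
open scoped Real

open Set Filter Topology MeasureTheory

/-! ### Contour representations -/

/-- The arc integral `∫₀^φ e^{z cos θ} dθ`. -/
noncomputable def besselArc (φ : ℝ) (z : ℂ) : ℂ :=
  ∫ θ in (0 : ℝ)..φ, Complex.exp (z * Real.cos θ)

/-- The integral of `e^{-z cosh t}` along the horizontal ray starting at `-iφ`. -/
noncomputable def besselRay (φ : ℝ) (z : ℂ) : ℂ :=
  ∫ t in Ioi (0 : ℝ), Complex.exp (z * -Complex.cosh (t - φ * Complex.I))

/-- The analytic continuation of `I₀` to the complex plane. -/
noncomputable def complexBesselI0 (z : ℂ) : ℂ :=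
  (besselArc (π / 2) z + besselArc (π / 2) (-z)) / π

/-- The analytic continuation of `K₀` to the half-plane `0 < re z + im z`. -/
noncomputable def complexBesselK0 (z : ℂ) : ℂ :=
  -Complex.I * besselArc (π / 4) (-z) + besselRay (π / 4) z

lemma differentiableAt_integral_cexp_mul {μ : Measure ℝ} {c : ℝ → ℂ} (hc : Continuous c)
    {bound : ℝ → ℝ} {z₀ : ℂ} {R : ℝ} (hR : 0 < R)
    (hb : ∀ᵐ t ∂μ, ∀ z ∈ Metric.ball z₀ R, ‖Complex.exp (z * c t)‖ ≤ bound t)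
    (hi : Integrable bound μ) :
    DifferentiableAt ℂ (fun z => ∫ t, Complex.exp (z * c t) ∂μ) z₀ := by
  have hcont : ∀ z : ℂ, Continuous fun t => Complex.exp (z * c t) := fun z => by fun_prop
  have hder : ∀ (t : ℝ) (z : ℂ),
      HasDerivAt (fun z => Complex.exp (z * c t)) (c t * Complex.exp (z * c t)) z := by
    intro t z
    have := ((hasDerivAt_id z).mul_const (c t)).cexp
    simpa [mul_comm] using this
  refine (hasDerivAt_integral_of_dominated_loc_of_deriv_le
    (F := fun z t => Complex.exp (z * c t)) (F' := fun z t => c t * Complex.exp (z * c t))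
    (bound := fun t => bound t / (R / 3))
    (Metric.ball_mem_nhds z₀ (half_pos hR))
    (Eventually.of_forall fun z => (hcont z).aestronglyMeasurable) ?_
    (hc.mul (hcont z₀)).aestronglyMeasurable ?_ (hi.div_const _)
    (Eventually.of_forall fun t z _ => hder t z)).2.differentiableAt
  · refine hi.mono' (hcont z₀).aestronglyMeasurable ?_
    filter_upwards [hb] with t ht using ht z₀ (Metric.mem_ball_self hR)
  · filter_upwards [hb] with t ht z hz
    rw [← (hder t z).deriv]
    refine Complex.norm_deriv_le_of_forall_mem_sphere_norm_le (by positivity)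
      (Differentiable.diffContOnCl fun w => (hder t w).differentiableAt) fun w hw => ht w ?_
    rw [Metric.mem_ball] at hz ⊢
    rw [Metric.mem_sphere] at hw
    linarith [dist_triangle w z z₀]

lemma norm_cexp_mul_cos_le (z : ℂ) (θ : ℝ) : ‖Complex.exp (z * Real.cos θ)‖ ≤ Real.exp ‖z‖ := by
  rw [Complex.norm_exp, Real.exp_le_exp]
  refine (Complex.re_le_norm _).trans ?_
  rw [norm_mul, Complex.norm_real]
  exact mul_le_of_le_one_right (norm_nonneg _) (Real.abs_cos_le_one θ)

lemma differentiable_besselArc {φ : ℝ} (hφ : 0 ≤ φ) : Differentiable ℂ (besselArc φ) := by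
  intro z₀
  unfold besselArc
  simp_rw [intervalIntegral.integral_of_le hφ]
  refine differentiableAt_integral_cexp_mul (bound := fun _ => Real.exp (‖z₀‖ + 1)) (R := 1)
    (by fun_prop) one_pos (Eventually.of_forall fun θ z hz => ?_) (integrable_const _)
  refine (norm_cexp_mul_cos_le z θ).trans (Real.exp_le_exp.2 ?_)
  have := norm_le_norm_add_norm_sub' z z₀
  rw [Metric.mem_ball, dist_eq_norm] at hz
  linarith

lemma norm_cexp_neg_cosh (z : ℂ) (t φ : ℝ) :
    ‖Complex.exp (z * -Complex.cosh (t - φ * Complex.I))‖ =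
      Real.exp (-(z.re * Real.cos φ * Real.cosh t + z.im * Real.sin φ * Real.sinh t)) := by
  rw [Complex.norm_exp]
  congr 1
  rw [Complex.cosh_sub, Complex.cosh_mul_I, Complex.sinh_mul_I, ← Complex.ofReal_cosh,
    ← Complex.ofReal_sinh, ← Complex.ofReal_cos, ← Complex.ofReal_sin]
  simp only [Complex.mul_re, Complex.mul_im, Complex.neg_re, Complex.neg_im, Complex.sub_re,
    Complex.sub_im, Complex.ofReal_re, Complex.ofReal_im, Complex.I_re, Complex.I_im]
  ring

lemma differentiableAt_besselRay {z₀ : ℂ} (h : 0 < z₀.re + z₀.im) :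
    DifferentiableAt ℂ (besselRay (π / 4)) z₀ := by
  set s := z₀.re + z₀.im with hs
  have h2 : 0 < √2 / 2 := by positivity
  refine differentiableAt_integral_cexp_mul (R := s / 4)
    (bound := fun t => Real.exp (‖z₀‖ + s) * Real.exp (-(√2 / 2 * (s / 2)) * t))
    (by fun_prop) (by positivity) ?_ ((exp_neg_integrableOn_Ioi 0 (by positivity)).const_mul _)
  filter_upwards [ae_restrict_mem measurableSet_Ioi] with t ht z hz
  rw [norm_cexp_neg_cosh, ← Real.exp_add, Real.exp_le_exp, Real.cos_pi_div_four,
    Real.sin_pi_div_four]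
  rw [mem_Ioi] at ht
  rw [Metric.mem_ball, dist_eq_norm] at hz
  have hre := (Complex.abs_re_le_norm (z - z₀)).trans hz.le
  have him := (Complex.abs_im_le_norm (z - z₀)).trans hz.le
  rw [Complex.sub_re, abs_le] at hre
  rw [Complex.sub_im, abs_le] at him
  have hsum : s / 2 ≤ z.re + z.im := by linarith [hre.1, him.1]
  have hz0 := abs_le.1 (Complex.abs_re_le_norm z₀)
  have hsinh : t ≤ Real.sinh t := Real.self_le_sinh_iff.2 ht.le
  have hexp : Real.cosh t = Real.sinh t + Real.exp (-t) := by
    rw [Real.cosh_eq, Real.sinh_eq]; ring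
  have he1 : Real.exp (-t) ≤ 1 := Real.exp_le_one_iff.2 (by linarith)
  have he0 := Real.exp_pos (-t)
  have hsq : √2 / 2 ≤ 1 := by
    have : √2 ≤ 2 := by rw [Real.sqrt_le_left (by norm_num)]; norm_num
    linarith
  have hlow : -(‖z₀‖ + s) ≤ z.re * Real.exp (-t) := by nlinarith
  have hmain : s / 2 * t ≤ (z.re + z.im) * Real.sinh t := by nlinarith
  rw [hexp]
  have hns : 0 ≤ ‖z₀‖ + s := by positivity
  nlinarith [mul_le_mul_of_nonneg_left hlow h2.le, mul_le_mul_of_nonneg_left hmain h2.le,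
    mul_le_mul_of_nonneg_right hsq hns]

lemma differentiable_complexBesselI0 : Differentiable ℂ complexBesselI0 := by
  have h := differentiable_besselArc (φ := π / 2) (by positivity)
  exact (h.add (h.comp differentiable_neg)).div_const _

lemma differentiableAt_complexBesselK0 {z : ℂ} (h : 0 < z.re + z.im) :
    DifferentiableAt ℂ complexBesselK0 z := by
  have h1 := differentiable_besselArc (φ := π / 4) (by positivity)
  exact ((h1.comp differentiable_neg).differentiableAt.const_mul _).add
    (differentiableAt_besselRay h)

lemma norm_cexp_neg_cosh_le {z : ℂ} (hre : 0 ≤ z.re) {t φ c : ℝ} (ht : 0 ≤ t) (h0 : 0 ≤ φ)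
    (h1 : φ ≤ π / 2) (hc : c ≤ z.re * Real.cos φ + z.im * Real.sin φ) :
    ‖Complex.exp (z * -Complex.cosh (t - φ * Complex.I))‖ ≤ Real.exp (-(c * Real.sinh t)) := by
  rw [norm_cexp_neg_cosh, Real.exp_le_exp, neg_le_neg_iff]
  have hcos : 0 ≤ Real.cos φ := Real.cos_nonneg_of_mem_Icc ⟨by linarith [Real.pi_pos], h1⟩
  have hsinh : 0 ≤ Real.sinh t := Real.sinh_nonneg_iff.2 ht
  nlinarith [mul_le_mul_of_nonneg_right hc hsinh,
    mul_le_mul_of_nonneg_left (Real.sinh_lt_cosh t).le (mul_nonneg hre hcos)]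

lemma norm_cexp_neg_cosh_le_exp {z : ℂ} (hre : 0 ≤ z.re) {t φ c : ℝ} (ht : 0 ≤ t) (h0 : 0 ≤ φ)
    (h1 : φ ≤ π / 2) (hc0 : 0 ≤ c) (hc : c ≤ z.re * Real.cos φ + z.im * Real.sin φ) :
    ‖Complex.exp (z * -Complex.cosh (t - φ * Complex.I))‖ ≤ Real.exp (-c * t) := by
  refine (norm_cexp_neg_cosh_le hre ht h0 h1 hc).trans (Real.exp_le_exp.2 ?_)
  nlinarith [mul_le_mul_of_nonneg_left (Real.self_le_sinh_iff.2 ht) hc0]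

lemma integrableOn_besselRay {z : ℂ} (hre : 0 ≤ z.re) {φ c : ℝ} (h0 : 0 ≤ φ)
    (h1 : φ ≤ π / 2) (hc0 : 0 < c) (hc : c ≤ z.re * Real.cos φ + z.im * Real.sin φ) :
    IntegrableOn (fun t : ℝ => Complex.exp (z * -Complex.cosh (t - φ * Complex.I))) (Ioi 0) := by
  refine Integrable.mono' (exp_neg_integrableOn_Ioi 0 hc0)
    (by fun_prop : Continuous _).aestronglyMeasurable ?_
  filter_upwards [ae_restrict_mem measurableSet_Ioi] with t ht
  exact norm_cexp_neg_cosh_le_exp hre (le_of_lt ht) h0 h1 hc0.le hc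

lemma besselRay_shift {z : ℂ} (hre : 0 ≤ z.re) {φ₁ φ₂ c : ℝ} (h0 : 0 ≤ φ₁) (h12 : φ₁ ≤ φ₂)
    (h2 : φ₂ ≤ π / 2) (hc0 : 0 < c)
    (hc : ∀ φ ∈ Icc φ₁ φ₂, c ≤ z.re * Real.cos φ + z.im * Real.sin φ) :
    -Complex.I * besselArc φ₁ (-z) + besselRay φ₁ z =
      -Complex.I * besselArc φ₂ (-z) + besselRay φ₂ z := by
  set f : ℂ → ℂ := fun w => Complex.exp (z * -Complex.cosh w) with hf
  have hfd : Differentiable ℂ f := by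
    intro w
    exact ((Complex.differentiable_cosh w).neg.const_mul z).cexp
  have hlim : ∀ φ ∈ Icc φ₁ φ₂, Tendsto (fun T : ℝ => ∫ t in (0 : ℝ)..T, f (t - φ * Complex.I))
      atTop (𝓝 (besselRay φ z)) := fun φ hφ =>
    intervalIntegral_tendsto_integral_Ioi 0 (integrableOn_besselRay hre (h0.trans hφ.1)
      (hφ.2.trans h2) hc0 (hc φ hφ)) tendsto_id
  have hside : Tendsto (fun T : ℝ => ∫ y in (-φ₁)..(-φ₂), f (T + y * Complex.I)) atTop (𝓝 0) := by
    have hexp : Tendsto (fun T : ℝ => Real.exp (-c * T) * |-φ₂ - -φ₁|) atTop (𝓝 0) := by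
      have : Tendsto (fun T : ℝ => Real.exp (-c * T)) atTop (𝓝 0) :=
        Real.tendsto_exp_atBot.comp (tendsto_id.const_mul_atTop_of_neg (by linarith))
      simpa using this.mul_const _
    refine squeeze_zero_norm' ?_ hexp
    filter_upwards [eventually_ge_atTop 0] with T hT
    refine intervalIntegral.norm_integral_le_of_norm_le_const fun y hy => ?_
    rw [uIoc_of_ge (by linarith)] at hy
    have := norm_cexp_neg_cosh_le_exp hre hT (φ := -y) (by linarith [hy.2]) (by linarith [hy.1])
      hc0.le (hc (-y) ⟨by linarith [hy.2], by linarith [hy.1]⟩)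
    simpa [hf] using this
  have harc : ∫ y in (-φ₁)..(-φ₂), f (y * Complex.I) =
      besselArc φ₁ (-z) - besselArc φ₂ (-z) := by
    have hcont : Continuous fun θ : ℝ => Complex.exp (-z * Real.cos θ) := by fun_prop
    unfold besselArc
    rw [intervalIntegral.integral_interval_sub_left (hcont.intervalIntegrable _ _)
      (hcont.intervalIntegrable _ _), ← intervalIntegral.integral_comp_neg]
    refine intervalIntegral.integral_congr fun y _ => ?_
    simp [hf, Complex.cosh_mul_I, ← neg_mul]
  have hrect : ∀ T : ℝ, (∫ t in (0 : ℝ)..T, f (t - φ₁ * Complex.I)) -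
      (∫ t in (0 : ℝ)..T, f (t - φ₂ * Complex.I)) +
      Complex.I * (∫ y in (-φ₁)..(-φ₂), f (T + y * Complex.I)) =
      Complex.I * (besselArc φ₁ (-z) - besselArc φ₂ (-z)) := by
    intro T
    have := Complex.integral_boundary_rect_eq_zero_of_differentiableOn f
      (-φ₁ * Complex.I) (T - φ₂ * Complex.I) hfd.differentiableOn
    simp only [Complex.mul_re, Complex.mul_im, Complex.neg_re, Complex.neg_im, Complex.sub_re,
      Complex.sub_im, Complex.ofReal_re, Complex.ofReal_im, Complex.I_re, Complex.I_im,
      smul_eq_mul, mul_zero, mul_one, sub_zero, zero_sub, neg_zero, add_zero, zero_add,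
      Complex.ofReal_neg, Complex.ofReal_zero, neg_mul, harc, ← sub_eq_add_neg] at this
    exact sub_eq_zero.1 this
  have hL := ((hlim φ₁ ⟨le_rfl, h12⟩).sub (hlim φ₂ ⟨h12, le_rfl⟩)).add
    (hside.const_mul Complex.I)
  have := tendsto_nhds_unique hL (tendsto_const_nhds.congr fun T => (hrect T).symm)
  linear_combination this

lemma complexBesselK0_ofReal {x : ℝ} (hx : 0 < x) : complexBesselK0 x = besselK0 x := by
  have hpi := Real.pi_pos
  unfold complexBesselK0
  rw [← besselRay_shift (z := x) (φ₁ := 0) (φ₂ := π / 4) (c := x * (√2 / 2)) (by simpa using hx.le)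
    le_rfl (by positivity) (by linarith) (by positivity) ?_]
  · simp only [besselArc, intervalIntegral.integral_same, mul_zero, zero_add, besselRay, besselK0]
    rw [← integral_complex_ofReal]
    refine setIntegral_congr_fun measurableSet_Ioi fun t _ => ?_
    simp
  · intro φ hφ
    have : √2 / 2 ≤ Real.cos φ := by
      rw [← Real.cos_pi_div_four]
      exact Real.cos_le_cos_of_nonneg_of_le_pi hφ.1 (by linarith) hφ.2
    simpa using mul_le_mul_of_nonneg_left this hx.le

lemma complexBesselI0_ofReal (x : ℝ) : complexBesselI0 x = besselI0 x := by
  have hcont : Continuous fun θ : ℝ => Real.exp (x * Real.cos θ) := by fun_prop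
  have harc : ∀ u : ℝ, besselArc (π / 2) u =
      ((∫ θ in (0 : ℝ)..(π / 2), Real.exp (u * Real.cos θ) : ℝ) : ℂ) := by
    intro u
    rw [besselArc, ← intervalIntegral.integral_ofReal]
    simp
  have href : ∫ θ in (0 : ℝ)..(π / 2), Real.exp (-x * Real.cos θ) =
      ∫ θ in (π / 2)..π, Real.exp (x * Real.cos θ) := by
    have := intervalIntegral.integral_comp_sub_left (a := 0) (b := π / 2)
      (fun θ => Real.exp (x * Real.cos θ)) π
    simp only [Real.cos_pi_sub, sub_zero] at this
    rw [show π - π / 2 = π / 2 by ring] at this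
    rw [← this]
    simp
  have hsplit := intervalIntegral.integral_add_adjacent_intervals
    (hcont.intervalIntegrable 0 (π / 2)) (hcont.intervalIntegrable (μ := volume) (π / 2) π)
  rw [complexBesselI0, harc, ← Complex.ofReal_neg, harc, href, ← Complex.ofReal_add, hsplit,
    besselI0]
  push_cast
  ring

lemma besselArc_conj (φ : ℝ) (z : ℂ) :
    besselArc φ ((starRingEnd ℂ) z) = (starRingEnd ℂ) (besselArc φ z) := by
  unfold besselArc
  rw [intervalIntegral, intervalIntegral, map_sub, ← integral_conj, ← integral_conj]
  simp only [← Complex.exp_conj, map_mul, Complex.conj_ofReal]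

lemma complexBesselK0_mul_I {y : ℝ} (hy : 0 < y) :
    complexBesselK0 (y * Complex.I) = -Complex.I * besselArc (π / 2) (-(y * Complex.I)) +
      ((∫ t in Ioi (0 : ℝ), Real.exp (-(y * Real.sinh t)) : ℝ) : ℂ) := by
  have hpi := Real.pi_pos
  unfold complexBesselK0
  rw [besselRay_shift (z := y * Complex.I) (φ₁ := π / 4) (φ₂ := π / 2) (c := y * (√2 / 2))
    (by simp) (by positivity) (by linarith) (by linarith) (by positivity) ?_]
  · congr 1
    rw [besselRay, ← integral_complex_ofReal]
    refine setIntegral_congr_fun measurableSet_Ioi fun t _ => ?_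
    have : Complex.cosh (t - (π / 2 : ℝ) * Complex.I) = -(Complex.sinh t * Complex.I) := by
      rw [Complex.cosh_sub, Complex.cosh_mul_I, Complex.sinh_mul_I]
      simp [Complex.cos_pi_div_two, Complex.sin_pi_div_two]
    simp only [this, Complex.ofReal_exp, Complex.ofReal_neg, Complex.ofReal_mul,
      Complex.ofReal_sinh]
    congr 1
    linear_combination (y * Complex.sinh t) * Complex.I_sq
  · intro φ hφ
    have : √2 / 2 ≤ Real.sin φ := by
      rw [← Real.sin_pi_div_four]
      exact Real.sin_le_sin_of_le_of_le_pi_div_two (by linarith) hφ.2 hφ.1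
    simpa using mul_le_mul_of_nonneg_left this hy.le

/-- On the positive imaginary axis `I₀` is real and `im K₀ = -(π/2) I₀`. -/
lemma exists_bessel_mul_I {y : ℝ} (hy : 0 < y) : ∃ p q : ℝ,
    complexBesselI0 (y * Complex.I) = 2 * q / π ∧
      complexBesselK0 (y * Complex.I) = p - q * Complex.I := by
  set b := besselArc (π / 2) (y * Complex.I) with hb
  have hneg : besselArc (π / 2) (-(y * Complex.I)) = (starRingEnd ℂ) b := by
    rw [hb, ← besselArc_conj]
    simp
  refine ⟨(∫ t in Ioi (0 : ℝ), Real.exp (-(y * Real.sinh t))) - b.im, b.re, ?_, ?_⟩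
  · rw [complexBesselI0, hneg, ← hb, Complex.add_conj]
    push_cast
    ring
  · rw [complexBesselK0_mul_I hy, hneg]
    apply Complex.ext <;> simp
    ring

/-! ### Estimates in the closed first quadrant -/

lemma norm_besselArc_le {z : ℂ} (hz : 1 ≤ ‖z‖) {M : ℝ}
    (hM : ∀ θ ∈ Icc (0 : ℝ) (π / 2), ‖Complex.exp (z * Real.cos θ)‖ ≤ M) :
    ‖besselArc (π / 2) z‖ ≤ (1 + π) * M / √‖z‖ := by
  have hpi := Real.pi_gt_three
  have hz0 : z ≠ 0 := norm_pos_iff.1 (by linarith)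
  have hr1 : 1 ≤ √‖z‖ := Real.one_le_sqrt.2 hz
  have hr0 : 0 < √‖z‖ := by linarith
  have hrr : √‖z‖ * √‖z‖ = ‖z‖ := Real.mul_self_sqrt (norm_nonneg z)
  have hM0 : 0 ≤ M := (norm_nonneg _).trans (hM 0 ⟨le_rfl, by positivity⟩)
  set δ := 1 / √‖z‖ with hδ
  have hδ0 : 0 < δ := by positivity
  have hδ1 : δ ≤ 1 := (div_le_one hr0).2 hr1
  have hδpi : δ ≤ π / 2 := by linarith
  have hsin : ∀ θ ∈ Icc δ (π / 2), 0 < Real.sin θ := fun θ hθ =>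
    Real.sin_pos_of_pos_of_lt_pi (by linarith [hθ.1]) (by linarith [hθ.2])
  have hsinδ : 2 / π * δ ≤ Real.sin δ := Real.mul_le_sin hδ0.le hδpi
  have hsinδ0 := hsin δ ⟨le_rfl, hδpi⟩
  have hcont : Continuous fun θ : ℝ => Complex.exp (z * Real.cos θ) := by fun_prop
  have hnear : ‖∫ θ in (0 : ℝ)..δ, Complex.exp (z * Real.cos θ)‖ ≤ M * δ := by
    have := intervalIntegral.norm_integral_le_of_norm_le_const (a := 0) (b := δ) (C := M)
      (f := fun θ : ℝ => Complex.exp (z * Real.cos θ)) fun θ hθ => by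
        rw [uIoc_of_le hδ0.le] at hθ
        exact hM θ ⟨hθ.1.le, hθ.2.trans hδpi⟩
    rwa [sub_zero, abs_of_pos hδ0] at this
  set H : ℝ → ℂ := fun θ => -(Complex.exp (z * Real.cos θ) / (z * Real.sin θ)) with hH
  set g : ℝ → ℂ := fun θ =>
    Complex.exp (z * Real.cos θ) * (Real.cos θ / (z * Real.sin θ ^ 2)) with hg
  have hderH : ∀ θ ∈ uIcc δ (π / 2),
      HasDerivAt H (Complex.exp (z * Real.cos θ) + g θ) θ := by
    intro θ hθ
    rw [uIcc_of_le hδpi] at hθ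
    have hs : (Real.sin θ : ℂ) ≠ 0 := Complex.ofReal_ne_zero.2 (hsin θ hθ).ne'
    have h1 : HasDerivAt (fun θ : ℝ => (Real.cos θ : ℂ)) (-Real.sin θ : ℝ) θ :=
      (Real.hasDerivAt_cos θ).ofReal_comp
    have h2 : HasDerivAt (fun θ : ℝ => (Real.sin θ : ℂ)) (Real.cos θ : ℝ) θ :=
      (Real.hasDerivAt_sin θ).ofReal_comp
    have := (((h1.const_mul z).cexp).div (h2.const_mul z) (mul_ne_zero hz0 hs)).neg
    refine this.congr_deriv ?_
    simp only [hg]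
    push_cast at hs ⊢
    field_simp
    ring
  have hgcont : ContinuousOn g (uIcc δ (π / 2)) := by
    rw [uIcc_of_le hδpi]
    refine hcont.continuousOn.mul (ContinuousOn.div (by fun_prop) (by fun_prop) fun θ hθ => ?_)
    exact mul_ne_zero hz0 (pow_ne_zero 2 (Complex.ofReal_ne_zero.2 (hsin θ hθ).ne'))
  have hgint : IntervalIntegrable g volume δ (π / 2) := hgcont.intervalIntegrable
  have hparts := intervalIntegral.integral_eq_sub_of_hasDerivAt hderH
    ((hcont.intervalIntegrable _ _).add hgint)
  rw [intervalIntegral.integral_add (hcont.intervalIntegrable _ _) hgint] at hparts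
  have hrint : ContinuousOn (fun θ => M / ‖z‖ * (Real.cos θ / Real.sin θ ^ 2))
      (uIcc δ (π / 2)) := by
    rw [uIcc_of_le hδpi]
    refine continuousOn_const.mul (ContinuousOn.div (by fun_prop) (by fun_prop) fun θ hθ => ?_)
    exact pow_ne_zero 2 (hsin θ hθ).ne'
  have hreal : ∫ θ in δ..(π / 2), M / ‖z‖ * (Real.cos θ / Real.sin θ ^ 2) =
      M / ‖z‖ * (1 / Real.sin δ - 1) := by
    have : ∀ θ ∈ uIcc δ (π / 2), HasDerivAt (fun θ => -(M / ‖z‖ * (Real.sin θ)⁻¹))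
        (M / ‖z‖ * (Real.cos θ / Real.sin θ ^ 2)) θ := by
      intro θ hθ
      rw [uIcc_of_le hδpi] at hθ
      refine ((((Real.hasDerivAt_sin θ).inv (hsin θ hθ).ne').const_mul (M / ‖z‖)).neg).congr_deriv
        ?_
      ring
    rw [intervalIntegral.integral_eq_sub_of_hasDerivAt this hrint.intervalIntegrable]
    simp
    ring
  have hgle : ‖∫ θ in δ..(π / 2), g θ‖ ≤ M / ‖z‖ * (1 / Real.sin δ - 1) := by
    rw [← hreal]
    refine intervalIntegral.norm_integral_le_of_norm_le hδpi
      (Eventually.of_forall fun θ hθ => ?_) hrint.intervalIntegrable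
    have hs := hsin θ ⟨hθ.1.le, hθ.2⟩
    have hcos : 0 ≤ Real.cos θ := Real.cos_nonneg_of_mem_Icc ⟨by linarith [hθ.1], hθ.2⟩
    simp only [hg, norm_mul, norm_div, norm_pow, Complex.norm_real, Real.norm_of_nonneg hs.le,
      Real.norm_of_nonneg hcos]
    have := mul_le_mul_of_nonneg_right (hM θ ⟨by linarith [hθ.1], hθ.2⟩)
      (by positivity : 0 ≤ Real.cos θ / (‖z‖ * Real.sin θ ^ 2))
    refine this.trans (le_of_eq ?_)
    field_simp
  have hHle : ∀ θ ∈ Icc δ (π / 2), ‖H θ‖ ≤ M / ‖z‖ * (1 / Real.sin θ) := by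
    intro θ hθ
    have hs := hsin θ hθ
    simp only [hH, norm_neg, norm_div, norm_mul, Complex.norm_real, Real.norm_of_nonneg hs.le]
    rw [div_mul_div_comm, mul_one]
    exact div_le_div_of_nonneg_right (hM θ ⟨by linarith [hθ.1], hθ.2⟩) (by positivity)
  have hfar : ‖∫ θ in δ..(π / 2), Complex.exp (z * Real.cos θ)‖ ≤ M * π / √‖z‖ := by
    have e1 := hHle (π / 2) ⟨hδpi, le_rfl⟩
    have e2 := hHle δ ⟨le_rfl, hδpi⟩
    rw [Real.sin_pi_div_two] at e1
    have e3 : ∫ θ in δ..(π / 2), Complex.exp (z * Real.cos θ) =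
        H (π / 2) - H δ - ∫ θ in δ..(π / 2), g θ := by
      rw [← hparts]; ring
    have e4 : 1 / Real.sin δ ≤ π / 2 * √‖z‖ := by
      rw [div_le_iff₀ hsinδ0]
      have : π / 2 * √‖z‖ * (2 / π * δ) = 1 := by
        rw [hδ]; field_simp
      rw [← this]
      exact mul_le_mul_of_nonneg_left hsinδ (by positivity)
    have e5 : M / ‖z‖ * (2 * (π / 2 * √‖z‖)) = M * π / √‖z‖ := by
      rw [div_mul_eq_mul_div, div_eq_div_iff (norm_ne_zero_iff.2 hz0) hr0.ne']
      linear_combination (M * π) * hrr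
    rw [e3, ← e5]
    have e6 : M / ‖z‖ * (2 * (1 / Real.sin δ)) ≤ M / ‖z‖ * (2 * (π / 2 * √‖z‖)) := by gcongr
    refine le_trans ?_ e6
    have := norm_sub_le (H (π / 2) - H δ) (∫ θ in δ..(π / 2), g θ)
    have := norm_sub_le (H (π / 2)) (H δ)
    linarith
  rw [besselArc, ← intervalIntegral.integral_add_adjacent_intervals
    (hcont.intervalIntegrable 0 δ) (hcont.intervalIntegrable δ (π / 2))]
  refine (norm_add_le _ _).trans ((add_le_add hnear hfar).trans (le_of_eq ?_))
  rw [hδ]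
  ring

lemma norm_cexp_mul_cos_le_exp_re {z : ℂ} (hre : 0 ≤ z.re) (θ : ℝ) :
    ‖Complex.exp (z * Real.cos θ)‖ ≤ Real.exp z.re := by
  rw [Complex.norm_exp, Real.exp_le_exp, Complex.re_mul_ofReal]
  exact mul_le_of_le_one_right hre (Real.cos_le_one θ)

lemma norm_cexp_neg_mul_cos_le_one {z : ℂ} (hre : 0 ≤ z.re) {θ : ℝ}
    (hθ : θ ∈ Icc (0 : ℝ) (π / 2)) : ‖Complex.exp (-z * Real.cos θ)‖ ≤ 1 := by
  rw [Complex.norm_exp, Real.exp_le_one_iff, Complex.re_mul_ofReal, Complex.neg_re]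
  have : 0 ≤ Real.cos θ :=
    Real.cos_nonneg_of_mem_Icc ⟨by linarith [hθ.1, Real.pi_pos], hθ.2⟩
  nlinarith [mul_nonneg hre this]

lemma norm_complexBesselI0_le_of_one_le {z : ℂ} (hre : 0 ≤ z.re) (hz : 1 ≤ ‖z‖) :
    ‖complexBesselI0 z‖ ≤ (1 + π) * Real.exp z.re / √‖z‖ := by
  have hpi := Real.pi_gt_three
  have h1 := norm_besselArc_le hz fun θ _ => norm_cexp_mul_cos_le_exp_re hre θ
  have h2 := norm_besselArc_le (z := -z) (by simpa using hz)
    fun θ hθ => norm_cexp_neg_mul_cos_le_one hre hθ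
  rw [norm_neg] at h2
  have h3 : (1 + π) * 1 / √‖z‖ ≤ (1 + π) * Real.exp z.re / √‖z‖ := by
    gcongr
    exact Real.one_le_exp hre
  have h0 : 0 ≤ (1 + π) * Real.exp z.re / √‖z‖ := by positivity
  rw [complexBesselI0, norm_div, Complex.norm_real, Real.norm_of_nonneg Real.pi_pos.le,
    div_le_iff₀ Real.pi_pos]
  have := norm_add_le (besselArc (π / 2) z) (besselArc (π / 2) (-z))
  nlinarith

lemma norm_complexBesselI0_le_of_le_one {z : ℂ} (hz : ‖z‖ ≤ 1) :
    ‖complexBesselI0 z‖ ≤ Real.exp 1 := by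
  have harc : ∀ w : ℂ, ‖w‖ ≤ 1 → ‖besselArc (π / 2) w‖ ≤ Real.exp 1 * (π / 2) := by
    intro w hw
    have := intervalIntegral.norm_integral_le_of_norm_le_const (a := 0) (b := π / 2)
      (C := Real.exp 1) (f := fun θ : ℝ => Complex.exp (w * Real.cos θ)) fun θ _ =>
        (norm_cexp_mul_cos_le w θ).trans (Real.exp_le_exp.2 hw)
    rwa [sub_zero, abs_of_pos (by positivity)] at this
  rw [complexBesselI0, norm_div, Complex.norm_real, Real.norm_of_nonneg Real.pi_pos.le,
    div_le_iff₀ Real.pi_pos]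
  have := norm_add_le (besselArc (π / 2) z) (besselArc (π / 2) (-z))
  linarith [harc z hz, harc (-z) (by simpa using hz)]

lemma pow_nine_le_sinh {t : ℝ} (ht : 0 ≤ t) : t ^ 9 / (Nat.factorial 9) ≤ Real.sinh t :=
  le_hasSum (Real.hasSum_sinh t) 4 fun n _ => by positivity

lemma norm_le_re_add_im {z : ℂ} (hre : 0 ≤ z.re) (him : 0 ≤ z.im) : ‖z‖ ≤ z.re + z.im := by
  simpa [abs_of_nonneg hre, abs_of_nonneg him] using Complex.norm_le_abs_re_add_abs_im z

lemma re_add_im_pos {z : ℂ} (hre : 0 ≤ z.re) (him : 0 ≤ z.im) (hz : z ≠ 0) :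
    0 < z.re + z.im :=
  (norm_pos_iff.2 hz).trans_le (norm_le_re_add_im hre him)

lemma exists_norm_complexBesselK0_le : ∃ C : ℝ, 0 ≤ C ∧ ∀ z : ℂ, 0 ≤ z.re → 0 ≤ z.im → z ≠ 0 →
    ‖complexBesselK0 z‖ ≤ π / 4 + C * ‖z‖ ^ (-1 / 9 : ℝ) := by
  have hpi := Real.pi_pos
  set a : ℝ := √2 / 2 / (Nat.factorial 9) with ha
  have ha0 : 0 < a := by positivity
  refine ⟨a ^ (-1 / 9 : ℝ) * Real.Gamma (1 / 9 + 1), by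
    have := Real.Gamma_pos_of_pos (s := 1 / 9 + 1) (by norm_num)
    positivity, fun z hre him hz => ?_⟩
  have hzpos := norm_pos_iff.2 hz
  have harc : ‖besselArc (π / 4) (-z)‖ ≤ π / 4 := by
    have := intervalIntegral.norm_integral_le_of_norm_le_const (a := 0) (b := π / 4)
      (C := 1) (f := fun θ : ℝ => Complex.exp (-z * Real.cos θ)) fun θ hθ => by
        rw [uIoc_of_le (by positivity)] at hθ
        exact norm_cexp_neg_mul_cos_le_one hre ⟨hθ.1.le, by linarith [hθ.2]⟩
    rwa [sub_zero, abs_of_pos (by positivity), one_mul] at this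
  have hray : ‖besselRay (π / 4) z‖ ≤
      a ^ (-1 / 9 : ℝ) * Real.Gamma (1 / 9 + 1) * ‖z‖ ^ (-1 / 9 : ℝ) := by
    have hG := integral_exp_neg_mul_rpow (p := 9) (b := a * ‖z‖) (by norm_num) (by positivity)
    have hint : IntegrableOn (fun t : ℝ => Real.exp (-(a * ‖z‖) * t ^ (9 : ℝ))) (Ioi 0) := by
      simpa using integrableOn_rpow_mul_exp_neg_mul_rpow (p := 9) (s := 0) (b := a * ‖z‖)
        (by norm_num) (by norm_num) (by positivity)
    rw [Real.mul_rpow ha0.le hzpos.le] at hG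
    rw [show a ^ (-1 / 9 : ℝ) * Real.Gamma (1 / 9 + 1) * ‖z‖ ^ (-1 / 9 : ℝ) =
      a ^ (-1 / 9 : ℝ) * ‖z‖ ^ (-1 / 9 : ℝ) * Real.Gamma (1 / 9 + 1) by ring, ← hG]
    refine norm_integral_le_of_norm_le hint ?_
    filter_upwards [ae_restrict_mem measurableSet_Ioi] with t ht
    have ht0 : 0 ≤ t := le_of_lt ht
    refine (norm_cexp_neg_cosh_le (c := √2 / 2 * ‖z‖) hre ht0 (by positivity) (by linarith)
      ?_).trans (Real.exp_le_exp.2 ?_)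
    · rw [Real.cos_pi_div_four, Real.sin_pi_div_four]
      nlinarith [mul_le_mul_of_nonneg_left (norm_le_re_add_im hre him)
        (by positivity : 0 ≤ √2 / 2)]
    · rw [show t ^ (9 : ℝ) = t ^ 9 by exact_mod_cast Real.rpow_natCast t 9]
      have := mul_le_mul_of_nonneg_left (pow_nine_le_sinh ht0)
        (by positivity : 0 ≤ √2 / 2 * ‖z‖)
      have e : √2 / 2 * ‖z‖ * (t ^ 9 / (Nat.factorial 9)) = a * ‖z‖ * t ^ 9 := by
        rw [ha]; ring
      linarith
  unfold complexBesselK0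
  refine (norm_add_le _ _).trans (add_le_add ?_ hray)
  simpa using harc

/-- Crude bounds for `K₀` near the origin and near infinity. -/
lemma exists_norm_complexBesselK0_crude : ∃ C : ℝ, 0 ≤ C ∧
    ∀ z : ℂ, 0 ≤ z.re → 0 ≤ z.im → z ≠ 0 →
      (‖z‖ ≤ 1 → ‖complexBesselK0 z‖ ≤ C * ‖z‖ ^ (-1 / 8 : ℝ)) ∧
      (1 ≤ ‖z‖ → ‖complexBesselK0 z‖ ≤ C) := by
  obtain ⟨C, hC, h⟩ := exists_norm_complexBesselK0_le
  refine ⟨π / 4 + C, by positivity, fun z hre him hz => ⟨fun h1 => ?_, fun h1 => ?_⟩⟩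
  · have hz0 := norm_pos_iff.2 hz
    have e1 : ‖z‖ ^ (-1 / 9 : ℝ) ≤ ‖z‖ ^ (-1 / 8 : ℝ) :=
      Real.rpow_le_rpow_of_exponent_ge hz0 h1 (by norm_num)
    have e2 : 1 ≤ ‖z‖ ^ (-1 / 8 : ℝ) :=
      Real.one_le_rpow_of_pos_of_le_one_of_nonpos hz0 h1 (by norm_num)
    have := h z hre him hz
    nlinarith [mul_le_mul_of_nonneg_left e1 hC, Real.pi_pos]
  · have e1 : ‖z‖ ^ (-1 / 9 : ℝ) ≤ 1 := Real.rpow_le_one_of_one_le_of_nonpos h1 (by norm_num)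
    have := h z hre him hz
    nlinarith [mul_le_mul_of_nonneg_left e1 hC]

lemma one_add_sq_div_two_le_cosh (t : ℝ) : 1 + t ^ 2 / 2 ≤ Real.cosh t := by
  have := sum_le_hasSum (Finset.range 2) (fun n _ =>
    div_nonneg ((even_two_mul n).pow_nonneg t) (Nat.cast_nonneg _)) (Real.hasSum_cosh t)
  simpa [Finset.sum_range_succ] using this

lemma norm_complexBesselK0_ofReal_le {x : ℝ} (hx : 0 < x) :
    Real.exp x * ‖complexBesselK0 x‖ ≤ π / √x := by
  have hpi := Real.pi_gt_three
  have hnn : 0 ≤ besselK0 x := setIntegral_nonneg measurableSet_Ioi fun t _ => (Real.exp_pos _).le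
  rw [complexBesselK0_ofReal hx, Complex.norm_real, Real.norm_of_nonneg hnn, besselK0,
    ← integral_const_mul]
  have hG := integral_gaussian_Ioi (x / 2)
  have hint : IntegrableOn (fun t : ℝ => Real.exp (-(x / 2) * t ^ 2)) (Ioi 0) :=
    (integrable_exp_neg_mul_sq (by positivity)).integrableOn
  have hle : ∫ t in Ioi (0 : ℝ), Real.exp x * Real.exp (-(x * Real.cosh t)) ≤
      ∫ t in Ioi (0 : ℝ), Real.exp (-(x / 2) * t ^ 2) := by
    refine integral_mono_of_nonneg (Eventually.of_forall fun t => by positivity) hint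
      (Eventually.of_forall fun t => ?_)
    simp only [← Real.exp_add, Real.exp_le_exp]
    nlinarith [mul_le_mul_of_nonneg_left (one_add_sq_div_two_le_cosh t) hx.le]
  refine hle.trans ?_
  rw [hG, show π / (x / 2) = 2 * π / x by field_simp, Real.sqrt_div' _ hx.le, div_div,
    mul_comm (√x), ← div_div]
  gcongr
  have : √(2 * π) ≤ 2 * π := by
    rw [Real.sqrt_le_left (by positivity)]
    nlinarith
  linarith

lemma norm_complexBesselK0_mul_I_le {y : ℝ} (hy : 1 ≤ y) :
    ‖complexBesselK0 (y * Complex.I)‖ ≤ (2 + π) / √y := by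
  have hy0 : 0 < y := by linarith
  have hnorm : ‖(y * Complex.I : ℂ)‖ = y := by simp [abs_of_pos hy0]
  have harc := norm_besselArc_le (z := -(y * Complex.I)) (by rwa [norm_neg, hnorm])
    fun θ hθ => norm_cexp_neg_mul_cos_le_one (by simp) hθ
  rw [norm_neg, hnorm, mul_one] at harc
  have hnn : 0 ≤ ∫ t in Ioi (0 : ℝ), Real.exp (-(y * Real.sinh t)) :=
    setIntegral_nonneg measurableSet_Ioi fun t _ => (Real.exp_pos _).le
  have hint : ∫ t in Ioi (0 : ℝ), Real.exp (-(y * Real.sinh t)) ≤ 1 / y := by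
    have h1 := integral_exp_mul_Ioi (a := -y) (by linarith) 0
    have h2 : ∫ t in Ioi (0 : ℝ), Real.exp (-(y * Real.sinh t)) ≤
        ∫ t in Ioi (0 : ℝ), Real.exp (-y * t) := by
      refine integral_mono_of_nonneg (Eventually.of_forall fun t => by positivity)
        (exp_neg_integrableOn_Ioi 0 hy0) ?_
      filter_upwards [ae_restrict_mem measurableSet_Ioi] with t ht
      rw [Real.exp_le_exp]
      nlinarith [mul_le_mul_of_nonneg_left (Real.self_le_sinh_iff.2 (le_of_lt ht)) hy0.le]
    refine h2.trans (le_of_eq ?_)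
    rw [h1]
    simp
  have hsq : 1 / y ≤ 1 / √y := by
    apply one_div_le_one_div_of_le (by positivity)
    rw [Real.sqrt_le_left hy0.le]
    nlinarith
  rw [complexBesselK0_mul_I hy0]
  refine (norm_add_le _ _).trans ?_
  rw [norm_mul, norm_neg, Complex.norm_I, one_mul, Complex.norm_real, Real.norm_of_nonneg hnn]
  have : (2 + π) / √y = (1 + π) / √y + 1 / √y := by ring
  linarith

/-- The Phragmén–Lindelöf principle gives the sharp decay of `K₀` in the closed first quadrant. -/
lemma exists_norm_mul_sq_complexBesselK0_le : ∃ C : ℝ, ∀ z : ℂ, 0 ≤ z.re → 0 ≤ z.im →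
    ‖z‖ * (Real.exp z.re * ‖complexBesselK0 z‖) ^ 2 ≤ C := by
  obtain ⟨C, hC0, hC⟩ := exists_norm_complexBesselK0_crude
  set f : ℂ → ℂ := fun z => z * (Complex.exp z * complexBesselK0 z) ^ 2 with hf
  have hfn : ∀ z, ‖f z‖ = ‖z‖ * (Real.exp z.re * ‖complexBesselK0 z‖) ^ 2 := fun z => by
    simp only [hf, norm_mul, norm_pow, Complex.norm_exp]
  have hf0 : f 0 = 0 := by simp [hf]
  have hsmall : ∀ z : ℂ, 0 ≤ z.re → 0 ≤ z.im → ‖z‖ ≤ 1 →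
      ‖f z‖ ≤ (Real.exp 1 * C) ^ 2 * ‖z‖ ^ (3 / 4 : ℝ) := by
    intro z hre him h1
    rcases eq_or_ne z 0 with rfl | hz
    · rw [hf0, norm_zero]; positivity
    have hz0 := norm_pos_iff.2 hz
    have hp : ‖z‖ * (‖z‖ ^ (-1 / 8 : ℝ)) ^ 2 = ‖z‖ ^ (3 / 4 : ℝ) := by
      rw [← Real.rpow_natCast, ← Real.rpow_mul hz0.le]
      nth_rewrite 1 [← Real.rpow_one ‖z‖]
      rw [← Real.rpow_add hz0]
      norm_num
    have he : Real.exp z.re ≤ Real.exp 1 := Real.exp_le_exp.2 ((Complex.re_le_norm z).trans h1)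
    have hK := (hC z hre him hz).1 h1
    calc ‖f z‖ ≤ ‖z‖ * (Real.exp 1 * (C * ‖z‖ ^ (-1 / 8 : ℝ))) ^ 2 := by rw [hfn]; gcongr
      _ = (Real.exp 1 * C) ^ 2 * (‖z‖ * (‖z‖ ^ (-1 / 8 : ℝ)) ^ 2) := by ring
      _ = _ := by rw [hp]
  have hdiff : ∀ z : ℂ, 0 ≤ z.re → 0 ≤ z.im → z ≠ 0 → DifferentiableAt ℂ f z := by
    intro z hre him hz
    have := differentiableAt_complexBesselK0 (re_add_im_pos hre him hz)
    exact differentiableAt_id.mul ((Complex.differentiable_exp.differentiableAt.mul this).pow 2)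
  have hclosure : closure (Ioi (0 : ℝ) ×ℂ Ioi (0 : ℝ)) = Ici (0 : ℝ) ×ℂ Ici (0 : ℝ) := by
    rw [Complex.closure_reProdIm, closure_Ioi]
  have hcl : DiffContOnCl ℂ f (Ioi (0 : ℝ) ×ℂ Ioi (0 : ℝ)) := by
    refine ⟨fun z hz => ?_, ?_⟩
    · rw [Complex.mem_reProdIm, mem_Ioi, mem_Ioi] at hz
      refine (hdiff z hz.1.le hz.2.le ?_).differentiableWithinAt
      rintro rfl
      simp at hz
    · rw [hclosure]
      intro z hz
      rcases eq_or_ne z 0 with rfl | hz0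
      · rw [ContinuousWithinAt, hf0]
        have hlim : Tendsto (fun z : ℂ => (Real.exp 1 * C) ^ 2 * ‖z‖ ^ (3 / 4 : ℝ))
            (𝓝[Ici (0 : ℝ) ×ℂ Ici (0 : ℝ)] 0) (𝓝 0) := by
          have : Continuous fun z : ℂ => (Real.exp 1 * C) ^ 2 * ‖z‖ ^ (3 / 4 : ℝ) :=
            continuous_const.mul (continuous_norm.rpow_const fun _ => Or.inr (by norm_num))
          have h := this.tendsto 0
          rw [norm_zero, Real.zero_rpow (by norm_num), mul_zero] at h
          exact h.mono_left nhdsWithin_le_nhds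
        refine squeeze_zero_norm' ?_ hlim
        filter_upwards [self_mem_nhdsWithin,
          mem_nhdsWithin_of_mem_nhds (Metric.closedBall_mem_nhds (0 : ℂ) one_pos)] with z hz h1
        exact hsmall z hz.1 hz.2 (by simpa using h1)
      · exact (hdiff z hz.1 hz.2 hz0).continuousAt.continuousWithinAt
  have hgrowth : ∃ c < (2 : ℝ), ∃ B,
      f =O[Bornology.cobounded ℂ ⊓ 𝓟 (Ioi (0 : ℝ) ×ℂ Ioi (0 : ℝ))]
        fun z => Real.exp (B * ‖z‖ ^ c) := by
    refine ⟨1, by norm_num, 3, Asymptotics.IsBigO.of_bound (C ^ 2) ?_⟩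
    rw [eventually_inf_principal]
    filter_upwards [tendsto_norm_cobounded_atTop.eventually_ge_atTop 1] with z h1 hz
    rw [Complex.mem_reProdIm, mem_Ioi, mem_Ioi] at hz
    have hK := (hC z hz.1.le hz.2.le (norm_pos_iff.1 (by linarith))).2 h1
    have he : Real.exp z.re ≤ Real.exp ‖z‖ := Real.exp_le_exp.2 (Complex.re_le_norm z)
    have hz1 : ‖z‖ ≤ Real.exp ‖z‖ := by linarith [Real.add_one_le_exp ‖z‖]
    rw [Real.rpow_one, Real.norm_of_nonneg (Real.exp_pos _).le]
    calc ‖f z‖ ≤ Real.exp ‖z‖ * (Real.exp ‖z‖ * C) ^ 2 := by rw [hfn]; gcongr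
      _ = C ^ 2 * Real.exp ‖z‖ ^ 3 := by ring
      _ = C ^ 2 * Real.exp (3 * ‖z‖) := by rw [← Real.exp_nat_mul]; norm_num
  set B : ℝ := π ^ 2 + (2 + π) ^ 2 + (Real.exp 1 * C) ^ 2 with hB
  have hpi := Real.pi_pos
  refine ⟨B, fun z hre him => ?_⟩
  rw [← hfn]
  refine PhragmenLindelof.quadrant_I hcl hgrowth (fun x hx => ?_) (fun y hy => ?_) hre him
  · rcases hx.eq_or_lt with rfl | hx
    · rw [Complex.ofReal_zero, hf0, norm_zero]; positivity
    rw [hfn, Complex.norm_real, Real.norm_of_nonneg hx.le, Complex.ofReal_re]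
    calc x * (Real.exp x * ‖complexBesselK0 x‖) ^ 2 ≤ x * (π / √x) ^ 2 := by
          gcongr
          exact norm_complexBesselK0_ofReal_le hx
      _ = π ^ 2 := by
          rw [div_pow, Real.sq_sqrt hx.le]
          field_simp
      _ ≤ B := by rw [hB]; nlinarith [sq_nonneg (2 + π), sq_nonneg (Real.exp 1 * C)]
  · have hnorm : ‖(y * Complex.I : ℂ)‖ = y := by simp [abs_of_nonneg hy]
    rcases le_total y 1 with h1 | h1
    · have := hsmall (y * Complex.I) (by simp) (by simpa using hy) (by rwa [hnorm])
      refine this.trans ?_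
      rw [hnorm]
      have h2 : y ^ (3 / 4 : ℝ) ≤ 1 := Real.rpow_le_one hy h1 (by norm_num)
      have h3 := mul_le_of_le_one_right (sq_nonneg (Real.exp 1 * C)) h2
      rw [hB]
      nlinarith [sq_nonneg (2 + π), sq_nonneg π]
    · have hy0 : 0 < y := by linarith
      have hre0 : (y * Complex.I : ℂ).re = 0 := by simp
      rw [hfn, hnorm, hre0, Real.exp_zero, one_mul]
      calc y * ‖complexBesselK0 (y * Complex.I)‖ ^ 2 ≤ y * ((2 + π) / √y) ^ 2 := by
            gcongr
            exact norm_complexBesselK0_mul_I_le h1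
        _ = (2 + π) ^ 2 := by
            rw [div_pow, Real.sq_sqrt hy0.le]
            field_simp
        _ ≤ B := by rw [hB]; nlinarith [sq_nonneg π, sq_nonneg (Real.exp 1 * C)]

lemma exists_norm_complexBesselK0_le_of_one_le : ∃ C : ℝ, 0 ≤ C ∧
    ∀ z : ℂ, 0 ≤ z.re → 0 ≤ z.im → 1 ≤ ‖z‖ →
      ‖complexBesselK0 z‖ ≤ C * Real.exp (-z.re) / √‖z‖ := by
  obtain ⟨C, hC⟩ := exists_norm_mul_sq_complexBesselK0_le
  refine ⟨√C, Real.sqrt_nonneg _, fun z hre him h1 => ?_⟩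
  have hz0 : 0 < √‖z‖ := Real.sqrt_pos.2 (by linarith)
  have h := Real.sqrt_le_sqrt (hC z hre him)
  rw [Real.sqrt_mul (norm_nonneg z), Real.sqrt_sq (by positivity)] at h
  rw [le_div_iff₀ hz0, Real.exp_neg, ← div_eq_mul_inv, le_div_iff₀ (Real.exp_pos _)]
  linarith

/-- The monomials `I₀(z)^j K₀(z)^k z^2` with `j + k = 8`, `j ≤ k`, are `O(|z|)` at the origin and
`O(|z|^{-1})` at infinity, uniformly in the closed first quadrant. -/
lemma exists_norm_bessel_monomial_le {j k : ℕ} (hjk : j + k = 8) (hle : j ≤ k) : ∃ C : ℝ,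
    ∀ z : ℂ, 0 ≤ z.re → 0 ≤ z.im → z ≠ 0 →
      ‖complexBesselI0 z ^ j * complexBesselK0 z ^ k * z ^ 2‖ ≤
        C * Real.exp (-|Real.log ‖z‖|) := by
  obtain ⟨C₁, hC₁, h₁⟩ := exists_norm_complexBesselK0_crude
  obtain ⟨C₂, hC₂, h₂⟩ := exists_norm_complexBesselK0_le_of_one_le
  have hpi := Real.pi_pos
  refine ⟨Real.exp 1 ^ j * C₁ ^ k + (1 + π) ^ j * C₂ ^ k, fun z hre him hz => ?_⟩
  have hz0 := norm_pos_iff.2 hz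
  rw [norm_mul, norm_mul, norm_pow, norm_pow, norm_pow]
  rcases le_total ‖z‖ 1 with h | h
  · rw [abs_of_nonpos (Real.log_nonpos hz0.le h), neg_neg, Real.exp_log hz0]
    set s := ‖z‖ ^ (-1 / 8 : ℝ) with hs
    have hs1 : 1 ≤ s := Real.one_le_rpow_of_pos_of_le_one_of_nonpos hz0 h (by norm_num)
    have hs8 : s ^ 8 * ‖z‖ = 1 := by
      rw [hs, ← Real.rpow_natCast, ← Real.rpow_mul hz0.le]
      norm_num
      rw [Real.rpow_neg_one]
      field_simp
    have hK := (h₁ z hre him hz).1 h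
    have hI := norm_complexBesselI0_le_of_le_one h
    calc ‖complexBesselI0 z‖ ^ j * ‖complexBesselK0 z‖ ^ k * ‖z‖ ^ 2
        ≤ Real.exp 1 ^ j * (C₁ * s) ^ k * ‖z‖ ^ 2 := by gcongr
      _ = Real.exp 1 ^ j * C₁ ^ k * (s ^ k * ‖z‖ ^ 2) := by ring
      _ ≤ Real.exp 1 ^ j * C₁ ^ k * (s ^ 8 * ‖z‖ ^ 2) := by
          gcongr
          omega
      _ = Real.exp 1 ^ j * C₁ ^ k * ‖z‖ := by
          linear_combination (Real.exp 1 ^ j * C₁ ^ k * ‖z‖) * hs8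
      _ ≤ _ := by
          gcongr
          exact le_add_of_nonneg_right (by positivity)
  · rw [abs_of_nonneg (Real.log_nonneg h), Real.exp_neg, Real.exp_log hz0]
    have hK := h₂ z hre him h
    have hI := norm_complexBesselI0_le_of_one_le hre h
    obtain ⟨m, rfl⟩ := Nat.exists_eq_add_of_le hle
    have he : Real.exp z.re ^ j * Real.exp (-z.re) ^ (j + m) ≤ 1 := by
      rw [pow_add, ← mul_assoc, ← mul_pow, ← Real.exp_add, add_neg_cancel, Real.exp_zero, one_pow,
        one_mul]
      exact pow_le_one₀ (Real.exp_pos _).le (Real.exp_le_one_iff.2 (by linarith))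
    have hs8 : √‖z‖ ^ j * √‖z‖ ^ (j + m) = ‖z‖ ^ 4 := by
      rw [← pow_add, hjk, show √‖z‖ ^ 8 = (√‖z‖ ^ 2) ^ 4 by ring, Real.sq_sqrt hz0.le]
    have hs0 : 0 < √‖z‖ := Real.sqrt_pos.2 hz0
    calc ‖complexBesselI0 z‖ ^ j * ‖complexBesselK0 z‖ ^ (j + m) * ‖z‖ ^ 2
        ≤ ((1 + π) * Real.exp z.re / √‖z‖) ^ j *
            (C₂ * Real.exp (-z.re) / √‖z‖) ^ (j + m) * ‖z‖ ^ 2 := by gcongr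
      _ = (1 + π) ^ j * C₂ ^ (j + m) * (Real.exp z.re ^ j * Real.exp (-z.re) ^ (j + m)) *
            (‖z‖ ^ 2 / (√‖z‖ ^ j * √‖z‖ ^ (j + m))) := by
          rw [div_pow, div_pow, mul_pow, mul_pow]
          field_simp
      _ ≤ (1 + π) ^ j * C₂ ^ (j + m) * 1 * (‖z‖ ^ 2 / (√‖z‖ ^ j * √‖z‖ ^ (j + m))) := by gcongr
      _ = (1 + π) ^ j * C₂ ^ (j + m) * (‖z‖ ^ 2)⁻¹ := by
          rw [hs8]
          field_simp
      _ ≤ (1 + π) ^ j * C₂ ^ (j + m) * ‖z‖⁻¹ := by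
          gcongr
          nlinarith
      _ ≤ _ := by
          gcongr
          exact le_add_of_nonneg_left (by positivity)

/-! ### Rotation of the contour in logarithmic coordinates -/

lemma exp_mem_quadrant {u : ℂ} (h0 : 0 ≤ u.im) (h1 : u.im ≤ π / 2) :
    0 ≤ (Complex.exp u).re ∧ 0 ≤ (Complex.exp u).im := by
  have hpi := Real.pi_pos
  rw [Complex.exp_re, Complex.exp_im]
  exact ⟨mul_nonneg (Real.exp_pos _).le
      (Real.cos_nonneg_of_mem_Icc ⟨by linarith, h1⟩),
    mul_nonneg (Real.exp_pos _).le
      (Real.sin_nonneg_of_nonneg_of_le_pi h0 (by linarith))⟩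

/-- The monomial `I₀(z)^j K₀(z)^k z dz` in the coordinate `z = e^u`. -/
noncomputable def logBesselMonomial (j k : ℕ) (u : ℂ) : ℂ :=
  complexBesselI0 (Complex.exp u) ^ j * complexBesselK0 (Complex.exp u) ^ k * Complex.exp u ^ 2

lemma exists_norm_logBesselMonomial_le {j k : ℕ} (hjk : j + k = 8) (hle : j ≤ k) : ∃ C : ℝ,
    ∀ u : ℂ, 0 ≤ u.im → u.im ≤ π / 2 →
      ‖logBesselMonomial j k u‖ ≤ C * Real.exp (-|u.re|) := by
  obtain ⟨C, hC⟩ := exists_norm_bessel_monomial_le hjk hle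
  refine ⟨C, fun u h0 h1 => ?_⟩
  have hq := exp_mem_quadrant h0 h1
  simpa only [logBesselMonomial, Complex.norm_exp, Real.log_exp] using hC _ hq.1 hq.2 (Complex.exp_ne_zero u)

lemma differentiableAt_logBesselMonomial (j k : ℕ) {u : ℂ} (h0 : 0 ≤ u.im) (h1 : u.im ≤ π / 2) :
    DifferentiableAt ℂ (logBesselMonomial j k) u := by
  have hq := exp_mem_quadrant h0 h1
  have he : DifferentiableAt ℂ Complex.exp u := Complex.differentiable_exp u
  have hI := (differentiable_complexBesselI0 (Complex.exp u)).comp u he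
  have hK := (differentiableAt_complexBesselK0
    (re_add_im_pos hq.1 hq.2 (Complex.exp_ne_zero u))).comp u he
  exact ((hI.pow j).mul (hK.pow k)).mul (he.pow 2)

lemma logBesselMonomial_ofReal (j k : ℕ) (x : ℝ) : logBesselMonomial j k x =
    ((besselI0 (Real.exp x) ^ j * besselK0 (Real.exp x) ^ k * Real.exp x ^ 2 : ℝ) : ℂ) := by
  rw [logBesselMonomial, ← Complex.ofReal_exp, complexBesselI0_ofReal,
    complexBesselK0_ofReal (Real.exp_pos x)]
  push_cast
  rfl

lemma besselMoment_eq_integral_exp (j k : ℕ) : besselMoment j k 1 =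
    ∫ x : ℝ, besselI0 (Real.exp x) ^ j * besselK0 (Real.exp x) ^ k * Real.exp x ^ 2 := by
  have := integral_image_eq_integral_abs_deriv_smul MeasurableSet.univ
    (fun x _ => (Real.hasDerivAt_exp x).hasDerivWithinAt) Real.exp_injective.injOn
    fun x => besselI0 x ^ j * besselK0 x ^ k * x ^ 1
  rw [image_univ, Real.range_exp, setIntegral_univ] at this
  rw [besselMoment, this]
  refine integral_congr_ae (Eventually.of_forall fun x => ?_)
  simp only [abs_of_pos (Real.exp_pos x), smul_eq_mul]
  ring

lemma integrable_exp_neg_abs : Integrable fun x : ℝ => Real.exp (-|x|) := by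
  rw [← integrableOn_univ, ← Iic_union_Ioi (a := (0 : ℝ)), integrableOn_union]
  constructor
  · refine (integrableOn_exp_Iic 0).congr_fun (fun x hx => ?_) measurableSet_Iic
    simp only [abs_of_nonpos (mem_Iic.1 hx), neg_neg]
  · refine (exp_neg_integrableOn_Ioi 0 one_pos).congr_fun (fun x hx => ?_) measurableSet_Ioi
    simp only [abs_of_pos (mem_Ioi.1 hx), neg_mul, one_mul]

lemma integrable_bessel_exp {j k : ℕ} (hjk : j + k = 8) (hle : j ≤ k) : Integrable
    fun x : ℝ => besselI0 (Real.exp x) ^ j * besselK0 (Real.exp x) ^ k * Real.exp x ^ 2 := by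
  obtain ⟨C, hC⟩ := exists_norm_logBesselMonomial_le hjk hle
  have hpi := Real.pi_pos
  have hcont : Continuous fun x : ℝ => logBesselMonomial j k x :=
    continuous_iff_continuousAt.2 fun x => ContinuousAt.comp (f := fun x : ℝ => (x : ℂ))
      (differentiableAt_logBesselMonomial j k (by simp) (by simpa using by positivity)).continuousAt
      Complex.continuous_ofReal.continuousAt
  have hint : Integrable fun x : ℝ => logBesselMonomial j k x :=
    (integrable_exp_neg_abs.const_mul C).mono' hcont.aestronglyMeasurable
      (Eventually.of_forall fun x => hC x (by simp) (by simpa using by positivity))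
  refine hint.re.congr (Eventually.of_forall fun x => ?_)
  simp only [logBesselMonomial_ofReal]
  exact Complex.ofReal_re _

/-- The combination of monomials whose real part vanishes on the imaginary axis. -/
noncomputable def logBesselForm (u : ℂ) : ℂ :=
  logBesselMonomial 1 7 u - π ^ 2 * logBesselMonomial 3 5 u +
    Complex.I * (-(1 / (4 * π)) * logBesselMonomial 0 8 u +
      3 * π / 2 * logBesselMonomial 2 6 u - π ^ 3 / 4 * logBesselMonomial 4 4 u)

lemma exists_norm_logBesselForm_le : ∃ C : ℝ, ∀ u : ℂ, 0 ≤ u.im → u.im ≤ π / 2 →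
    ‖logBesselForm u‖ ≤ C * Real.exp (-|u.re|) := by
  obtain ⟨A, hA⟩ := exists_norm_logBesselMonomial_le (j := 1) (k := 7) rfl (by norm_num)
  obtain ⟨B, hB⟩ := exists_norm_logBesselMonomial_le (j := 3) (k := 5) rfl (by norm_num)
  obtain ⟨C, hC⟩ := exists_norm_logBesselMonomial_le (j := 0) (k := 8) rfl (by norm_num)
  obtain ⟨D, hD⟩ := exists_norm_logBesselMonomial_le (j := 2) (k := 6) rfl (by norm_num)
  obtain ⟨E, hE⟩ := exists_norm_logBesselMonomial_le (j := 4) (k := 4) rfl (by norm_num)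
  refine ⟨A + ‖(π ^ 2 : ℂ)‖ * B + (‖(-(1 / (4 * π)) : ℂ)‖ * C + ‖(3 * π / 2 : ℂ)‖ * D +
    ‖(π ^ 3 / 4 : ℂ)‖ * E), fun u h0 h1 => ?_⟩
  have hmul : ∀ (c m : ℂ) (M : ℝ), ‖m‖ ≤ M * Real.exp (-|u.re|) →
      ‖c * m‖ ≤ ‖c‖ * M * Real.exp (-|u.re|) := fun c m M h => by
    rw [norm_mul, mul_assoc]
    exact mul_le_mul_of_nonneg_left h (norm_nonneg c)
  rw [logBesselForm, add_mul, add_mul, add_mul, add_mul]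
  refine norm_add_le_of_le (norm_sub_le_of_le (hA u h0 h1) (hmul _ _ _ (hB u h0 h1))) ?_
  rw [norm_mul, Complex.norm_I, one_mul]
  exact norm_sub_le_of_le (norm_add_le_of_le (hmul _ _ _ (hC u h0 h1)) (hmul _ _ _ (hD u h0 h1)))
    (hmul _ _ _ (hE u h0 h1))

lemma differentiableAt_logBesselForm {u : ℂ} (h0 : 0 ≤ u.im) (h1 : u.im ≤ π / 2) :
    DifferentiableAt ℂ logBesselForm u := by
  have h := fun j k => differentiableAt_logBesselMonomial j k h0 h1
  exact ((h 1 7).sub ((h 3 5).const_mul _)).add (((((h 0 8).const_mul _).add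
    ((h 2 6).const_mul _)).sub ((h 4 4).const_mul _)).const_mul _)

lemma logBesselForm_re_ofReal (x : ℝ) : (logBesselForm x).re =
    besselI0 (Real.exp x) ^ 1 * besselK0 (Real.exp x) ^ 7 * Real.exp x ^ 2 -
      π ^ 2 * (besselI0 (Real.exp x) ^ 3 * besselK0 (Real.exp x) ^ 5 * Real.exp x ^ 2) := by
  have hI : ∀ a b c d e : ℝ, (((a : ℂ) - π ^ 2 * b) + Complex.I *
      (-(1 / (4 * π)) * c + 3 * π / 2 * d - π ^ 3 / 4 * e)).re = a - π ^ 2 * b := by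
    intro a b c d e
    have : ((a : ℂ) - π ^ 2 * b) + Complex.I *
        (-(1 / (4 * π)) * c + 3 * π / 2 * d - π ^ 3 / 4 * e) =
        ((a - π ^ 2 * b : ℝ) : ℂ) +
          ((-(1 / (4 * π)) * c + 3 * π / 2 * d - π ^ 3 / 4 * e : ℝ) : ℂ) * Complex.I := by
      push_cast
      ring
    rw [this, Complex.add_re, Complex.ofReal_re, Complex.re_ofReal_mul, Complex.I_re, mul_zero,
      add_zero]
  simp only [logBesselForm, logBesselMonomial_ofReal]
  exact hI _ _ _ _ _

lemma logBesselForm_re_add_pi_div_two (x : ℝ) :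
    (logBesselForm (x + (π / 2 : ℝ) * Complex.I)).re = 0 := by
  have hexp : Complex.exp (x + (π / 2 : ℝ) * Complex.I) = (Real.exp x : ℝ) * Complex.I := by
    rw [Complex.exp_add, Complex.ofReal_exp, Complex.ofReal_div, Complex.ofReal_ofNat,
      Complex.exp_pi_div_two_mul_I]
  obtain ⟨p, q, hI, hK⟩ := exists_bessel_mul_I (Real.exp_pos x)
  have hpi : (π : ℂ) ≠ 0 := Complex.ofReal_ne_zero.2 Real.pi_ne_zero
  simp only [logBesselForm, logBesselMonomial, hexp, hI, hK]
  generalize hk : (p - q * Complex.I : ℂ) = k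
  set r := Real.exp x
  have hN : ((p : ℂ) ^ 2 + q ^ 2) ^ 4 = k ^ 4 * (k ^ 4 + 8 * Complex.I * q * k ^ 3 -
      24 * q ^ 2 * k ^ 2 - 32 * Complex.I * q ^ 3 * k + 16 * q ^ 4) := by
    have hkk : (p : ℂ) ^ 2 + q ^ 2 = k * (k + 2 * q * Complex.I) := by
      rw [← hk]
      linear_combination q ^ 2 * Complex.I_sq
    rw [hkk, mul_pow]
    linear_combination k ^ 4 * (24 * q ^ 2 * k ^ 2 + 32 * q ^ 3 * k * Complex.I +
      16 * q ^ 4 * (Complex.I ^ 2 - 1)) * Complex.I_sq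
  have hs : (2 * q / π : ℂ) ^ 1 * k ^ 7 * (r * Complex.I) ^ 2 -
      π ^ 2 * ((2 * q / π : ℂ) ^ 3 * k ^ 5 * (r * Complex.I) ^ 2) +
      Complex.I * (-(1 / (4 * π)) * ((2 * q / π : ℂ) ^ 0 * k ^ 8 * (r * Complex.I) ^ 2) +
        3 * π / 2 * ((2 * q / π : ℂ) ^ 2 * k ^ 6 * (r * Complex.I) ^ 2) -
        π ^ 3 / 4 * ((2 * q / π : ℂ) ^ 4 * k ^ 4 * (r * Complex.I) ^ 2)) =
      ((r ^ 2 * (p ^ 2 + q ^ 2) ^ 4 / (4 * π) : ℝ) : ℂ) * Complex.I := by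
    push_cast
    rw [hN, mul_pow, Complex.I_sq]
    field_simp
    ring_nf
    simp only [Complex.I_sq]
    ring
  rw [hs, Complex.re_ofReal_mul, Complex.I_re, mul_zero]

/-- `M(1,7,1) = π²·M(3,5,1)`. -/
theorem bessel_moment_M171 :
    besselMoment 1 7 1 = π ^ 2 * besselMoment 3 5 1 := by
  have hpi := Real.pi_pos
  have hi17 := integrable_bessel_exp (j := 1) (k := 7) rfl (by norm_num)
  have hi35 := (integrable_bessel_exp (j := 3) (k := 5) rfl (by norm_num)).const_mul (π ^ 2)
  rw [← sub_eq_zero, besselMoment_eq_integral_exp, besselMoment_eq_integral_exp,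
    ← integral_const_mul, ← integral_sub hi17 hi35]
  simp only [← logBesselForm_re_ofReal]
  have hint : Integrable fun x : ℝ => (logBesselForm x).re := by
    simp only [logBesselForm_re_ofReal]
    exact hi17.sub hi35
  have hlim := intervalIntegral_tendsto_integral hint tendsto_neg_atTop_atBot tendsto_id
  refine tendsto_nhds_unique hlim ?_
  obtain ⟨C, hC⟩ := exists_norm_logBesselForm_le
  have hside : ∀ T a : ℝ, |a| = T →
      ‖∫ y in (0 : ℝ)..(π / 2), logBesselForm (a + y * Complex.I)‖ ≤
        C * Real.exp (-T) * (π / 2) := by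
    intro T a ha
    have := intervalIntegral.norm_integral_le_of_norm_le_const (a := 0) (b := π / 2)
      (C := C * Real.exp (-T)) (f := fun y : ℝ => logBesselForm (a + y * Complex.I)) fun y hy => by
        rw [uIoc_of_le (by positivity)] at hy
        simpa [ha] using hC (a + y * Complex.I) (by simpa using hy.1.le) (by simpa using hy.2)
    rwa [sub_zero, abs_of_pos (by positivity)] at this
  have hcontAt : ∀ (x : ℝ) {y : ℝ}, 0 ≤ y → y ≤ π / 2 →
      ContinuousAt (fun x : ℝ => logBesselForm (x + y * Complex.I)) x := fun x y h0 h1 =>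
    ContinuousAt.comp (f := fun x : ℝ => (x + y * Complex.I : ℂ))
      (differentiableAt_logBesselForm (by simpa using h0) (by simpa using h1)).continuousAt
      (by fun_prop)
  have hre : ∀ {y : ℝ}, 0 ≤ y → y ≤ π / 2 → ∀ T : ℝ,
      (∫ x in (-T)..T, logBesselForm (x + y * Complex.I)).re =
        ∫ x in (-T)..T, (logBesselForm (x + y * Complex.I)).re := fun h0 h1 T => by
    have hi : IntervalIntegrable (fun x : ℝ => logBesselForm (x + _ * Complex.I)) volume (-T) T :=
      (continuous_iff_continuousAt.2 fun x => hcontAt x h0 h1).intervalIntegrable _ _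
    exact (Complex.reCLM.intervalIntegral_comp_comm hi).symm
  have hbound : ∀ T : ℝ, 0 ≤ T →
      ‖∫ x in (-T)..T, (logBesselForm x).re‖ ≤ C * π * Real.exp (-T) := by
    intro T hT
    have hrect := Complex.integral_boundary_rect_eq_zero_of_differentiableOn logBesselForm
      (-T : ℝ) (T + (π / 2 : ℝ) * Complex.I) fun u hu => by
        have := hu.2
        simp only [mem_preimage, Complex.ofReal_im, Complex.add_im,
          Complex.im_ofReal_mul, Complex.I_im, mul_one, zero_add,
          uIcc_of_le (show 0 ≤ π / 2 by positivity)] at this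
        exact (differentiableAt_logBesselForm this.1 this.2).differentiableWithinAt
    simp only [Complex.ofReal_re, Complex.ofReal_im, Complex.add_re, Complex.add_im,
      Complex.re_ofReal_mul, Complex.im_ofReal_mul, Complex.I_re, Complex.I_im, mul_zero, mul_one,
      zero_add, add_zero] at hrect
    have h1 := hre le_rfl (by positivity) T
    simp only [Complex.ofReal_zero, zero_mul, add_zero] at h1
    have h2 := hre (y := π / 2) (by positivity) le_rfl T
    simp only [logBesselForm_re_add_pi_div_two, intervalIntegral.integral_zero] at h2
    have h3 := hside T T (abs_of_nonneg hT)
    have h4 := hside T (-T) (by rw [abs_neg, abs_of_nonneg hT])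
    have h5 := congrArg Complex.re hrect
    simp only [Complex.add_re, Complex.sub_re, h1, h2, smul_eq_mul, Complex.I_mul_re,
      Complex.zero_re, Complex.ofReal_zero, zero_mul, add_zero] at h5
    have h6 := (Complex.abs_im_le_norm _).trans h3
    have h7 := (Complex.abs_im_le_norm _).trans h4
    rw [Real.norm_eq_abs]
    rw [abs_le] at h6 h7 ⊢
    constructor <;> linarith [h6.1, h6.2, h7.1, h7.2]
  have hzero : Tendsto (fun T : ℝ => C * π * Real.exp (-T)) atTop (𝓝 0) := by
    simpa using (Real.tendsto_exp_neg_atTop_nhds_zero).const_mul (C * π)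
  refine squeeze_zero_norm' ?_ hzero
  filter_upwards [eventually_ge_atTop 0] with T hT using hbound T hT
end
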